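/- arXiv:2012.05014 — 5 statements merged into one kernel-verified Lean document; each statement's English description precedes it below -/
import Mathlib

section
/- Let a be a symmetric positive definite d×d real matrix and let y ∈ ℝ^d. Then the function x ↦ p_a(x,y) is twice differentiable on ℝ^d and its Hessian is given by ∇²_x p_a(x,y) = p_a(x,y) · [ (a^{-1}(y−x)) (a^{-1}(y−x))^T − a^{-1} ] for all x ∈ ℝ^d, where v v^T denotes the outer product of v ∈ ℝ^d with itself. -/
open MeasureTheory Real Filter
open scoped ENNReal RealInnerProductSpace

noncomputable section

abbrev Ed (d : ℕ) := EuclideanSpace ℝ (Fin d)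

/-- Gaussian reference kernel `p̃^{K,τ}(x,y) = (4Kπτ)^{-d/2} exp(-|y-x|²/(4Kτ))`. -/
def gaussK (d : ℕ) (K τ : ℝ) (x y : Ed d) : ℝ :=
  (4 * K * Real.pi * τ) ^ (-(d : ℝ) / 2) * Real.exp (-‖y - x‖ ^ 2 / (4 * K * τ))

/-- Gaussian density with covariance matrix `a`:
`p_a(x,y) = (2π)^{-d/2} (det a)^{-1/2} exp(-½⟨a⁻¹(y-x), y-x⟩)`. -/
def pG (d : ℕ) (a : Matrix (Fin d) (Fin d) ℝ) (x y : Ed d) : ℝ :=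
  (2 * Real.pi) ^ (-(d : ℝ) / 2) * a.det ^ (-(1 : ℝ) / 2) *
    Real.exp (-(1 / 2) * ⟪Matrix.toEuclideanLin a⁻¹ (y - x), y - x⟫)

/-- Operator norm of a matrix acting between Euclidean spaces. -/
def opN {d m : ℕ} (a : Matrix (Fin d) (Fin m) ℝ) : ℝ :=
  ‖LinearMap.toContinuousLinearMap (Matrix.toEuclideanLin a)‖

/-- `(K,τ)`-ellipticity: `(τ/K)|ξ|² ≤ ⟨aξ, ξ⟩ ≤ Kτ|ξ|²` for all `ξ`. -/
def IsElliptic {d : ℕ} (K τ : ℝ) (a : Matrix (Fin d) (Fin d) ℝ) : Prop :=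
  ∀ ξ : Ed d, (τ / K) * ‖ξ‖ ^ 2 ≤ ⟪Matrix.toEuclideanLin a ξ, ξ⟫ ∧
    ⟪Matrix.toEuclideanLin a ξ, ξ⟫ ≤ K * τ * ‖ξ‖ ^ 2

/-- Gradient `∇_x p_a(x,y)` of the Gaussian density in the first variable. -/
def gradP (d : ℕ) (a : Matrix (Fin d) (Fin d) ℝ) (y x : Ed d) : Ed d :=
  gradient (fun w => pG d a w y) x

/-- Hessian `∇²_x p_a(x,y)` (as a continuous linear map) of the Gaussian density
in the first variable. -/
def hessP (d : ℕ) (a : Matrix (Fin d) (Fin d) ℝ) (y x : Ed d) : Ed d →L[ℝ] Ed d :=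
  fderiv ℝ (gradP d a y) x

/-- Localized norm `‖g‖_{L̃_p^q([s,t])}` (valued in `ℝ≥0∞`). -/
def tnorm (d : ℕ) (p q s t : ℝ) (g : ℝ → Ed d → ℝ) : ℝ≥0∞ :=
  ⨆ z : Ed d, (∫⁻ u in Set.Icc s t,
    (∫⁻ x in Metric.closedBall z 1, ENNReal.ofReal (|g u x| ^ p)) ^ (q / p)) ^ (1 / q)

/-- A symmetric real matrix acts as a symmetric operator on Euclidean space. -/
theorem inner_toEuclideanLin_comm {d : ℕ} {b : Matrix (Fin d) (Fin d) ℝ} (hb : b.IsSymm)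
    (u v : Ed d) :
    ⟪Matrix.toEuclideanLin b u, v⟫ = ⟪Matrix.toEuclideanLin b v, u⟫ := by
  have h : b.IsHermitian := by
    rw [Matrix.IsHermitian, Matrix.conjTranspose_eq_transpose_of_trivial]
    exact hb
  rw [Matrix.isSymmetric_toEuclideanLin_iff.2 h u v, real_inner_comm]

theorem hasFDerivAt_toEuclideanLin_sub {d : ℕ} (b : Matrix (Fin d) (Fin d) ℝ) (x y : Ed d) :
    HasFDerivAt (fun w => Matrix.toEuclideanLin b (y - w))
      (-LinearMap.toContinuousLinearMap (Matrix.toEuclideanLin b)) x := by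
  have h := (LinearMap.toContinuousLinearMap (Matrix.toEuclideanLin b)).hasFDerivAt.comp x
    ((hasFDerivAt_id x).const_sub y)
  refine h.congr_fderiv ?_
  refine ContinuousLinearMap.ext fun v => ?_
  simp

/-- The gradient of the Gaussian density is `p_a(x,y) a⁻¹(y - x)`. -/
theorem hasGradientAt_pG {d : ℕ} {a : Matrix (Fin d) (Fin d) ℝ} (hsymm : a.IsSymm)
    (x y : Ed d) :
    HasGradientAt (fun w => pG d a w y)
      (pG d a x y • Matrix.toEuclideanLin a⁻¹ (y - x)) x := by
  have hb : (a⁻¹).IsSymm := by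
    rw [Matrix.IsSymm, Matrix.transpose_nonsing_inv, hsymm]
  have h := ((((hasFDerivAt_toEuclideanLin_sub a⁻¹ x y).inner ℝ
    ((hasFDerivAt_id x).const_sub y)).const_mul (-(1 / 2))).exp).const_mul
      ((2 * Real.pi) ^ (-(d : ℝ) / 2) * a.det ^ (-(1 : ℝ) / 2))
  rw [hasGradientAt_iff_hasFDerivAt]
  refine h.congr_fderiv ?_
  refine ContinuousLinearMap.ext fun v => ?_
  have hc := inner_toEuclideanLin_comm hb v (y - x)
  simp [pG, inner_sub_left, hc]
  ring

theorem gradP_eq {d : ℕ} {a : Matrix (Fin d) (Fin d) ℝ} (hsymm : a.IsSymm) (x y : Ed d) :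
    gradP d a y x = pG d a x y • Matrix.toEuclideanLin a⁻¹ (y - x) :=
  (hasGradientAt_pG hsymm x y).gradient

/-- `x ↦ p_a(x,y)` is twice differentiable with Hessian
`∇²_x p_a(x,y) = p_a(x,y) [ (a⁻¹(y−x))(a⁻¹(y−x))ᵀ − a⁻¹ ]`. -/
theorem stmt3 (d : ℕ) (a : Matrix (Fin d) (Fin d) ℝ)
    (hsymm : a.IsSymm) (hpos : a.PosDef) (y : Ed d) :
    ∀ x : Ed d,
      HasGradientAt (fun w => pG d a w y) (gradP d a y x) x ∧
      HasFDerivAt (fun w => gradP d a y w)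
        (LinearMap.toContinuousLinearMap (Matrix.toEuclideanLin
          (pG d a x y •
            (Matrix.vecMulVec (fun i => Matrix.toEuclideanLin a⁻¹ (y - x) i)
              (fun i => Matrix.toEuclideanLin a⁻¹ (y - x) i) - a⁻¹)))) x := by
  intro x
  have hg := hasGradientAt_pG hsymm x y
  refine ⟨by rwa [gradP_eq hsymm], ?_⟩
  simp only [gradP_eq hsymm]
  refine (hg.hasFDerivAt.smul (hasFDerivAt_toEuclideanLin_sub a⁻¹ x y)).congr_fderiv ?_
  refine ContinuousLinearMap.ext fun v => ?_
  ext i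
  simp [Matrix.toLpLin_apply, Matrix.vecMulVec_mulVec, PiLp.inner_apply, dotProduct,
    mul_comm (v.ofLp _)]
  ring
end
end

section
/- For every d ≥ 1 and K ≥ 1 there exists a constant c > 0, depending only on d and K, such that the following holds: for every τ > 0 and η ≥ 0, if a and a' are symmetric positive definite d×d real matrices which are both (K,τ)-elliptic and satisfy ‖a − a'‖ ≤ Kτη in operator norm, then for all x, y ∈ ℝ^d, (1 + |x−y|²/τ) · |p_a(x,y) − p_{a'}(x,y)| ≤ c · η · p̃^{K,τ}(x,y). -/
open MeasureTheory Real Filter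
open scoped ENNReal RealInnerProductSpace

noncomputable section

/-- A real symmetric matrix dominating the identity has determinant at least `1`. -/
theorem Matrix.PosSemidef.one_le_det_of_sub_one {n : Type*} [Fintype n] [DecidableEq n]
    {M : Matrix n n ℝ} (h : (M - 1).PosSemidef) : 1 ≤ M.det := by
  have hM : M.IsHermitian := by
    simpa using h.isHermitian.add Matrix.isHermitian_one
  rw [hM.det_eq_prod_eigenvalues]
  have key : ∀ i, 1 ≤ hM.eigenvalues i := by
    intro i
    have h0 := h.dotProduct_mulVec_nonneg (hM.eigenvectorBasis i).ofLp
    have hne : (hM.eigenvectorBasis i).ofLp ≠ 0 := by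
      intro h0
      exact hM.eigenvectorBasis.orthonormal.ne_zero i (by ext j; simpa using congrFun h0 j)
    rw [Matrix.sub_mulVec, hM.mulVec_eigenvectorBasis, Matrix.one_mulVec, dotProduct_sub,
      dotProduct_smul, smul_eq_mul] at h0
    have hpos := Matrix.dotProduct_star_self_pos_iff.2 hne
    rw [star_trivial] at h0 hpos
    nlinarith
  calc (1 : ℝ) = ∏ _i : n, (1 : ℝ) := by simp
    _ ≤ _ := Finset.prod_le_prod (fun _ _ => zero_le_one) (fun i _ => by simpa using key i)

open scoped MatrixOrder Matrix in
/-- The determinant is monotone for the Loewner order. -/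
theorem Matrix.PosDef.det_le_det {n : Type*} [Fintype n] [DecidableEq n]
    {A B : Matrix n n ℝ} (hB : B.PosDef) (h : (A - B).PosSemidef) : B.det ≤ A.det := by
  obtain ⟨S, hS⟩ := CStarAlgebra.nonneg_iff_eq_star_mul_self.1 hB.posSemidef.nonneg
  have hdet : B.det = S.det * S.det := by
    rw [hS, Matrix.det_mul, Matrix.star_eq_conjTranspose, Matrix.det_conjTranspose, star_trivial]
  have hBpos := hB.det_pos
  have hS0 : IsUnit S.det := isUnit_iff_ne_zero.2 fun h0 => by simp [hdet, h0] at hBpos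
  have h1 := h.conjTranspose_mul_mul_same S⁻¹
  have h2 : (S⁻¹)ᴴ * (A - B) * S⁻¹ = (S⁻¹)ᴴ * A * S⁻¹ - 1 := by
    rw [mul_sub, sub_mul, hS, Matrix.star_eq_conjTranspose]
    congr 1
    rw [Matrix.conjTranspose_nonsing_inv, ← mul_assoc,
      Matrix.nonsing_inv_mul _ (by simpa [Matrix.det_conjTranspose] using hS0), one_mul,
      Matrix.mul_nonsing_inv _ hS0]
  rw [h2] at h1
  have h3 := h1.one_le_det_of_sub_one
  rw [Matrix.det_mul, Matrix.det_mul, Matrix.det_conjTranspose, star_trivial,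
    Matrix.det_nonsing_inv, Ring.inverse_eq_inv'] at h3
  have h4 : S.det⁻¹ * A.det * S.det⁻¹ = A.det / B.det := by
    rw [hdet]; field_simp
  rw [h4, one_le_div hBpos] at h3
  exact h3

/-- Nonnegativity of the Euclidean quadratic form gives positive semidefiniteness. -/
theorem posSemidef_of_inner_nonneg {d : ℕ} {A : Matrix (Fin d) (Fin d) ℝ} (hA : A.IsSymm)
    (h : ∀ ξ : Ed d, 0 ≤ ⟪Matrix.toEuclideanLin A ξ, ξ⟫) : A.PosSemidef := by
  rw [← Matrix.isPositive_toEuclideanLin_iff]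
  refine ⟨Matrix.isSymmetric_toEuclideanLin_iff.2 ?_, fun ξ => by simpa using h ξ⟩
  rw [Matrix.IsHermitian, Matrix.conjTranspose_eq_transpose_of_trivial]
  exact hA

theorem toEuclideanLin_inner_comm {d : ℕ} {A : Matrix (Fin d) (Fin d) ℝ} (hA : A.IsSymm)
    (x y : Ed d) : ⟪Matrix.toEuclideanLin A x, y⟫ = ⟪x, Matrix.toEuclideanLin A y⟫ := by
  refine Matrix.isSymmetric_toEuclideanLin_iff.2 ?_ x y
  rw [Matrix.IsHermitian, Matrix.conjTranspose_eq_transpose_of_trivial]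
  exact hA

theorem toEuclideanLin_apply_inv {d : ℕ} {A : Matrix (Fin d) (Fin d) ℝ} (hA : A.PosDef)
    (v : Ed d) : Matrix.toEuclideanLin A (Matrix.toEuclideanLin A⁻¹ v) = v := by
  ext i
  simp [Matrix.toLpLin_apply, Matrix.mulVec_mulVec,
    Matrix.mul_nonsing_inv _ (isUnit_iff_ne_zero.2 hA.det_pos.ne')]

theorem norm_toEuclideanLin_le {d : ℕ} (A : Matrix (Fin d) (Fin d) ℝ) (v : Ed d) :
    ‖Matrix.toEuclideanLin A v‖ ≤ opN A * ‖v‖ :=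
  (LinearMap.toContinuousLinearMap (Matrix.toEuclideanLin A)).le_opNorm v

section Elliptic

variable {d : ℕ} {K τ η : ℝ} {a a' : Matrix (Fin d) (Fin d) ℝ}

theorem IsElliptic.norm_inv_le (hK : 0 < K) (hτ : 0 < τ) (ha : a.PosDef)
    (he : IsElliptic K τ a) (v : Ed d) : ‖Matrix.toEuclideanLin a⁻¹ v‖ ≤ K / τ * ‖v‖ := by
  have h1 := (he (Matrix.toEuclideanLin a⁻¹ v)).1
  rw [toEuclideanLin_apply_inv ha] at h1
  have h2 := real_inner_le_norm v (Matrix.toEuclideanLin a⁻¹ v)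
  rcases (norm_nonneg (Matrix.toEuclideanLin a⁻¹ v)).eq_or_lt with h0 | h0
  · rw [← h0]; positivity
  · have h3 : τ / K * ‖Matrix.toEuclideanLin a⁻¹ v‖ ≤ ‖v‖ := by
      refine le_of_mul_le_mul_right ?_ h0
      nlinarith
    have h4 := mul_le_mul_of_nonneg_left h3 (div_pos hK hτ).le
    rw [← mul_assoc, div_mul_div_cancel₀ hτ.ne', div_self hK.ne', one_mul] at h4
    exact h4

theorem IsElliptic.le_inner_inv (hK : 0 < K) (hτ : 0 < τ) (hs : a.IsSymm) (ha : a.PosDef)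
    (he : IsElliptic K τ a) (v : Ed d) :
    ‖v‖ ^ 2 / (K * τ) ≤ ⟪Matrix.toEuclideanLin a⁻¹ v, v⟫ := by
  set w := Matrix.toEuclideanLin a⁻¹ v with hw
  have haw : Matrix.toEuclideanLin a w = v := toEuclideanLin_apply_inv ha v
  have h1 := (he (w - (1 / (K * τ)) • v)).1
  have h2 := (he v).2
  have h3 : ⟪Matrix.toEuclideanLin a v, w⟫ = ‖v‖ ^ 2 := by
    rw [toEuclideanLin_inner_comm hs, haw, real_inner_self_eq_norm_sq]
  rw [map_sub, map_smul, haw, inner_sub_left, inner_sub_right, inner_sub_right,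
    inner_smul_left, inner_smul_left, inner_smul_right, inner_smul_right, h3,
    real_inner_self_eq_norm_sq, real_inner_comm] at h1
  simp only [conj_trivial] at h1
  have h4 : 0 ≤ τ / K * ‖w - (1 / (K * τ)) • v‖ ^ 2 := by positivity
  have h5 : 1 / (K * τ) * (1 / (K * τ) * ⟪Matrix.toEuclideanLin a v, v⟫) ≤
      1 / (K * τ) * (1 / (K * τ) * (K * τ * ‖v‖ ^ 2)) := by gcongr
  have h6 : 1 / (K * τ) * (1 / (K * τ) * (K * τ * ‖v‖ ^ 2)) = 1 / (K * τ) * ‖v‖ ^ 2 := by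
    field_simp
  have h7 : ‖v‖ ^ 2 / (K * τ) = 1 / (K * τ) * ‖v‖ ^ 2 := by ring
  linarith

theorem abs_inner_inv_sub_le (hK : 0 < K) (hτ : 0 < τ) (hs : a.IsSymm)
    (ha : a.PosDef) (ha' : a'.PosDef) (he : IsElliptic K τ a) (he' : IsElliptic K τ a')
    (hη : 0 ≤ η) (hop : opN (a - a') ≤ K * τ * η) (v : Ed d) :
    |⟪Matrix.toEuclideanLin a⁻¹ v, v⟫ - ⟪Matrix.toEuclideanLin a'⁻¹ v, v⟫| ≤
      K ^ 3 * η * (‖v‖ ^ 2 / τ) := by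
  have hw := he.norm_inv_le hK hτ ha v
  have hw' := he'.norm_inv_le hK hτ ha' v
  have haw := toEuclideanLin_apply_inv ha v
  have haw' := toEuclideanLin_apply_inv ha' v
  set w := Matrix.toEuclideanLin a⁻¹ v
  set w' := Matrix.toEuclideanLin a'⁻¹ v
  have h1 : ⟪w, v⟫ - ⟪w', v⟫ = - ⟪w, Matrix.toEuclideanLin (a - a') w'⟫ := by
    have e1 : ⟪w, v⟫ = ⟪w, Matrix.toEuclideanLin a' w'⟫ := by rw [haw']
    have e2 : ⟪w', v⟫ = ⟪w, Matrix.toEuclideanLin a w'⟫ := by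
      rw [← toEuclideanLin_inner_comm hs, haw, real_inner_comm]
    rw [e1, e2, map_sub, LinearMap.sub_apply, inner_sub_right]
    ring
  rw [h1, abs_neg]
  calc |⟪w, Matrix.toEuclideanLin (a - a') w'⟫|
      ≤ ‖w‖ * ‖Matrix.toEuclideanLin (a - a') w'‖ := abs_real_inner_le_norm _ _
    _ ≤ (K / τ * ‖v‖) * ((K * τ * η) * (K / τ * ‖v‖)) := by
        gcongr
        exact (norm_toEuclideanLin_le _ _).trans (by gcongr)
    _ = K ^ 3 * η * (‖v‖ ^ 2 / τ) := by field_simp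

theorem IsElliptic.pow_le_det (hK : 0 < K) (hτ : 0 < τ) (hs : a.IsSymm)
    (he : IsElliptic K τ a) : (τ / K) ^ d ≤ a.det := by
  have hpos : ((τ / K) • (1 : Matrix (Fin d) (Fin d) ℝ)).PosDef :=
    Matrix.PosDef.one.smul (div_pos hτ hK)
  have h := hpos.det_le_det (A := a) (posSemidef_of_inner_nonneg
    (hs.sub (Matrix.isSymm_one.smul _)) fun ξ => ?_)
  · simpa [Matrix.det_smul] using h
  · rw [map_sub, map_smul, LinearMap.sub_apply, LinearMap.smul_apply, inner_sub_left,
      inner_smul_left]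
    have := (he ξ).1
    have h1 : Matrix.toEuclideanLin (1 : Matrix (Fin d) (Fin d) ℝ) ξ = ξ := by
      ext i; simp
    rw [h1, real_inner_self_eq_norm_sq]
    simpa using this

theorem IsElliptic.det_le_pow_mul_det (hK : 0 < K) (hτ : 0 < τ) (hs : a.IsSymm) (hs' : a'.IsSymm)
    (ha' : a'.PosDef) (he : IsElliptic K τ a) (hη : 0 ≤ η) (hop : opN (a - a') ≤ K * τ * η) :
    a'.det ≤ (1 + K ^ 2 * η) ^ d * a.det := by
  have h := ha'.det_le_det (A := (1 + K ^ 2 * η) • a) (posSemidef_of_inner_nonneg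
    ((hs.smul _).sub hs') fun ξ => ?_)
  · simpa [Matrix.det_smul] using h
  · have h1 : (1 + K ^ 2 * η) • a - a' = (K ^ 2 * η) • a + (a - a') := by
      rw [add_smul, one_smul]; abel
    rw [h1, map_add, map_smul, LinearMap.add_apply, LinearMap.smul_apply, inner_add_left,
      inner_smul_left]
    have h2 : -⟪Matrix.toEuclideanLin (a - a') ξ, ξ⟫ ≤ K * τ * η * ‖ξ‖ ^ 2 := by
      refine (neg_le_abs _).trans ((abs_real_inner_le_norm _ _).trans ?_)
      calc ‖Matrix.toEuclideanLin (a - a') ξ‖ * ‖ξ‖ ≤ (K * τ * η * ‖ξ‖) * ‖ξ‖ := by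
            gcongr
            exact (norm_toEuclideanLin_le _ _).trans (by gcongr)
        _ = _ := by ring
    have h3 := mul_le_mul_of_nonneg_left (he ξ).1 (by positivity : 0 ≤ K ^ 2 * η)
    have h4 : K ^ 2 * η * (τ / K * ‖ξ‖ ^ 2) = K * τ * η * ‖ξ‖ ^ 2 := by field_simp
    simp only [conj_trivial]
    linarith

end Elliptic

/-- If `D' ≤ (1 + t) ^ d * D`, then `D ^ (-1/2) - D' ^ (-1/2)` is at most linear in `t`. -/
theorem rpow_neg_half_sub_le {d : ℕ} {D D' t : ℝ} (hD : 0 < D) (hD' : 0 < D') (ht : 0 ≤ t)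
    (h : D' ≤ (1 + t) ^ d * D) :
    D ^ (-(1 : ℝ) / 2) - D' ^ (-(1 : ℝ) / 2) ≤ d * t / 2 * D ^ (-(1 : ℝ) / 2) := by
  have h1 : ((1 + t) ^ d * D) ^ (-(1 : ℝ) / 2) ≤ D' ^ (-(1 : ℝ) / 2) :=
    rpow_le_rpow_of_nonpos hD' h (by norm_num)
  rw [mul_rpow (by positivity) hD.le, ← rpow_natCast, ← rpow_mul (by positivity)] at h1
  have h2 : 1 - d * t / 2 ≤ (1 + t) ^ ((d : ℝ) * (-1 / 2)) := by
    rw [rpow_def_of_pos (by positivity)]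
    have h3 := add_one_le_exp (log (1 + t) * ((d : ℝ) * (-1 / 2)))
    have h4 : log (1 + t) ≤ t := by
      have := log_le_sub_one_of_pos (by positivity : 0 < 1 + t); linarith
    have h5 := mul_le_mul_of_nonneg_left h4 (Nat.cast_nonneg (α := ℝ) d)
    linarith
  have h6 := mul_le_mul_of_nonneg_right h2 (rpow_pos_of_pos hD (-(1 : ℝ) / 2)).le
  linarith

theorem abs_exp_neg_sub_le {p q m : ℝ} (hp : m ≤ p) (hq : m ≤ q) :
    |exp (-p) - exp (-q)| ≤ |p - q| * exp (-m) := by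
  wlog h : p ≤ q generalizing p q
  · rw [abs_sub_comm, abs_sub_comm p]
    exact this hq hp (le_of_not_ge h)
  have h1 : exp (-q) ≤ exp (-p) := exp_le_exp.2 (by linarith)
  rw [abs_of_nonneg (by linarith), abs_of_nonpos (by linarith)]
  have h2 : exp (-q) = exp (-p) * exp (p - q) := by rw [← exp_add]; congr 1; ring
  have h3 := add_one_le_exp (p - q)
  have h4 : exp (-p) ≤ exp (-m) := exp_le_exp.2 (by linarith)
  have h5 := exp_pos (-p)
  calc exp (-p) - exp (-q) = exp (-p) * (1 - exp (p - q)) := by rw [h2]; ring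
    _ ≤ exp (-p) * (-(p - q)) := by gcongr; linarith
    _ ≤ exp (-m) * (-(p - q)) := by gcongr; linarith
    _ = _ := mul_comm _ _

theorem one_add_sq_mul_exp_le {K r : ℝ} (hK : 1 ≤ K) (hr : 0 ≤ r) :
    (1 + r) ^ 2 * exp (-(r / (2 * K))) ≤ 64 * K ^ 2 * exp (-(r / (4 * K))) := by
  have hK0 : 0 < K := by linarith
  have h1 : 1 + r ≤ 8 * K * exp (r / (8 * K)) := by
    have h := mul_le_mul_of_nonneg_left (add_one_le_exp (r / (8 * K)))
      (by positivity : 0 ≤ 8 * K)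
    have e : 8 * K * (r / (8 * K) + 1) = r + 8 * K := by field_simp
    linarith
  calc (1 + r) ^ 2 * exp (-(r / (2 * K)))
      ≤ (8 * K * exp (r / (8 * K))) ^ 2 * exp (-(r / (2 * K))) := by gcongr
    _ = 64 * K ^ 2 * (exp (r / (8 * K)) * exp (r / (8 * K)) * exp (-(r / (2 * K)))) := by ring
    _ = 64 * K ^ 2 * exp (-(r / (4 * K))) := by
        rw [← exp_add, ← exp_add]; congr 2; field_simp; ring

/-- stability of the Gaussian density in its covariance matrix:
`(1 + |x−y|²/τ) |p_a(x,y) − p_{a'}(x,y)| ≤ c η p̃^{K,τ}(x,y)` when `‖a − a'‖ ≤ Kτη`. -/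
theorem stmt5 (d : ℕ) (hd : 1 ≤ d) (K : ℝ) (hK : 1 ≤ K) :
    ∃ c > 0, ∀ τ η : ℝ, 0 < τ → 0 ≤ η →
      ∀ a a' : Matrix (Fin d) (Fin d) ℝ,
        a.IsSymm → a.PosDef → a'.IsSymm → a'.PosDef →
        IsElliptic K τ a → IsElliptic K τ a' →
        opN (a - a') ≤ K * τ * η → ∀ x y : Ed d,
          (1 + ‖x - y‖ ^ 2 / τ) * |pG d a x y - pG d a' x y| ≤
            c * η * gaussK d K τ x y := by
  have hK0 : 0 < K := by linarith
  have hd' : (1 : ℝ) ≤ d := by exact_mod_cast hd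
  refine ⟨(1 / (2 * K ^ 2)) ^ (-(d : ℝ) / 2) * (d * K ^ 3) * (64 * K ^ 2), by positivity, ?_⟩
  intro τ η hτ hη a a' hs ha hs' ha' he he' hop x y
  have hop' : opN (a' - a) ≤ K * τ * η := by
    refine le_trans (le_of_eq ?_) hop
    rw [opN, opN, ← neg_sub a a', map_neg, map_neg, norm_neg]
  have hQ := abs_inner_inv_sub_le hK0 hτ hs ha ha' he he' hη hop (y - x)
  have hl := he.le_inner_inv hK0 hτ hs ha (y - x)
  have hl' := he'.le_inner_inv hK0 hτ hs' ha' (y - x)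
  have hD := he.det_le_pow_mul_det hK0 hτ hs hs' ha' hη hop
  have hD' := he'.det_le_pow_mul_det hK0 hτ hs' hs ha hη hop'
  have hb := he.pow_le_det hK0 hτ hs
  have hb' := he'.pow_le_det hK0 hτ hs'
  have hdp := ha.det_pos
  have hdp' := ha'.det_pos
  unfold pG gaussK
  rw [norm_sub_rev x y]
  set r := ‖y - x‖ ^ 2 / τ with hr
  have hr0 : 0 ≤ r := by positivity
  set q := ⟪Matrix.toEuclideanLin a⁻¹ (y - x), y - x⟫
  set q' := ⟪Matrix.toEuclideanLin a'⁻¹ (y - x), y - x⟫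
  set M : ℝ := ((τ / K) ^ d) ^ (-(1 : ℝ) / 2) with hM
  have hM0 : 0 < M := by positivity
  have hpow : ∀ {D : ℝ}, (τ / K) ^ d ≤ D → D ^ (-(1 : ℝ) / 2) ≤ M := fun h =>
    rpow_le_rpow_of_nonpos (by positivity) h (by norm_num)
  set s := a.det ^ (-(1 : ℝ) / 2)
  set s' := a'.det ^ (-(1 : ℝ) / 2)
  have hsM : s ≤ M := hpow hb
  have hsM' : s' ≤ M := hpow hb'
  have hs0' : 0 ≤ s' := by positivity
  have hsub : |s - s'| ≤ d * (K ^ 2 * η) / 2 * M := by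
    have h1 := rpow_neg_half_sub_le hdp hdp' (by positivity : 0 ≤ K ^ 2 * η) hD
    have h2 := rpow_neg_half_sub_le hdp' hdp (by positivity : 0 ≤ K ^ 2 * η) hD'
    refine abs_sub_le_iff.2 ⟨h1.trans ?_, h2.trans ?_⟩ <;> gcongr
  have hlr : r / (2 * K) ≤ 1 / 2 * q := by
    have e : r / (2 * K) = 1 / 2 * (‖y - x‖ ^ 2 / (K * τ)) := by rw [hr]; field_simp
    rw [e]; gcongr
  have hlr' : r / (2 * K) ≤ 1 / 2 * q' := by
    have e : r / (2 * K) = 1 / 2 * (‖y - x‖ ^ 2 / (K * τ)) := by rw [hr]; field_simp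
    rw [e]; gcongr
  set E := exp (-(r / (2 * K)))
  have hexp : |exp (-(1 / 2) * q) - exp (-(1 / 2) * q')| ≤ K ^ 3 * η * r / 2 * E := by
    have h := abs_exp_neg_sub_le hlr hlr'
    rw [← mul_sub, abs_mul, abs_of_pos (by norm_num : (0 : ℝ) < 1 / 2)] at h
    rw [neg_mul, neg_mul]
    refine h.trans ?_
    gcongr
    linarith
  have hexp1 : exp (-(1 / 2) * q) ≤ E := exp_le_exp.2 (by linarith)
  have hdiff : |s * exp (-(1 / 2) * q) - s' * exp (-(1 / 2) * q')| ≤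
      M * (d * K ^ 3) * η * (1 + r) * E := by
    have e : s * exp (-(1 / 2) * q) - s' * exp (-(1 / 2) * q') =
      (s - s') * exp (-(1 / 2) * q) + s' * (exp (-(1 / 2) * q) - exp (-(1 / 2) * q')) := by ring
    rw [e]
    refine (abs_add_le _ _).trans ?_
    rw [abs_mul, abs_mul, abs_of_nonneg hs0', abs_of_pos (exp_pos _)]
    calc _ ≤ d * (K ^ 2 * η) / 2 * M * E + M * (K ^ 3 * η * r / 2 * E) := by gcongr
      _ ≤ d * (K ^ 3 * η) * M * E + M * (d * K ^ 3 * η * r * E) := by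
        gcongr ?_ * M * E + M * (?_ * E)
        · have : K ^ 2 ≤ K ^ 3 := pow_le_pow_right₀ hK (by norm_num)
          have h2 : (d : ℝ) * (K ^ 2 * η) ≤ d * (K ^ 3 * η) := by gcongr
          have h3 : 0 ≤ (d : ℝ) * (K ^ 3 * η) := by positivity
          linarith
        · have h3 : 0 ≤ K ^ 3 * η * r := by positivity
          nlinarith
      _ = _ := by ring
  have hconst : (2 * π) ^ (-(d : ℝ) / 2) * M =
      (1 / (2 * K ^ 2)) ^ (-(d : ℝ) / 2) * (4 * K * π * τ) ^ (-(d : ℝ) / 2) := by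
    rw [hM, ← rpow_natCast, ← rpow_mul (by positivity), mul_div_assoc', mul_neg_one,
      ← mul_rpow (by positivity) (by positivity), ← mul_rpow (by positivity) (by positivity)]
    congr 1
    field_simp
    ring
  have hE : -‖y - x‖ ^ 2 / (4 * K * τ) = -(r / (4 * K)) := by rw [hr]; field_simp
  have hfin := one_add_sq_mul_exp_le hK hr0
  rw [hE, mul_assoc, mul_assoc _ s', ← mul_sub, abs_mul,
    abs_of_pos (by positivity : 0 < (2 * π) ^ (-(d : ℝ) / 2))]
  calc _ ≤ (1 + r) * ((2 * π) ^ (-(d : ℝ) / 2) * (M * (d * K ^ 3) * η * (1 + r) * E)) := by gcongr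
    _ = ((2 * π) ^ (-(d : ℝ) / 2) * M) * (d * K ^ 3) * η * ((1 + r) ^ 2 * E) := by ring
    _ ≤ ((2 * π) ^ (-(d : ℝ) / 2) * M) * (d * K ^ 3) * η *
        (64 * K ^ 2 * exp (-(r / (4 * K)))) := by gcongr
    _ = _ := by rw [hconst]; ring
end
end

section
/- For every d ≥ 1 and K ≥ 1 there exists a constant c > 0, depending only on d and K, such that the following holds: for every τ > 0 and η ≥ 0, if a and a' are symmetric positive definite d×d real matrices which are both (K,τ)-elliptic and satisfy ‖a − a'‖ ≤ Kτη in operator norm, then for all x, y ∈ ℝ^d, √τ · |∇_x p_a(x,y) − ∇_x p_{a'}(x,y)| + τ · ‖∇²_x p_a(x,y) − ∇²_x p_{a'}(x,y)‖ ≤ c · η · p̃^{K,τ}(x,y), where ‖·‖ is the operator norm on d×d matrices. -/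
open MeasureTheory Real Filter
open scoped ENNReal RealInnerProductSpace

noncomputable section

section Normalizer

open scoped Matrix.Norms.L2Operator

theorem Matrix.l2_opNorm_eq_opN {d m : ℕ} (a : Matrix (Fin d) (Fin m) ℝ) : ‖a‖ = opN a :=
  Matrix.l2_opNorm_def a

theorem Matrix.det_ne_zero_of_coercive {d : ℕ} {k : ℝ} (hk : 0 < k)
    {b : Matrix (Fin d) (Fin d) ℝ}
    (hb : ∀ ξ : Ed d, k * ‖ξ‖ ^ 2 ≤ ⟪Matrix.toEuclideanLin b ξ, ξ⟫) : b.det ≠ 0 := by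
  intro h
  obtain ⟨v, hv, hbv⟩ := Matrix.exists_mulVec_eq_zero_iff.mpr h
  have h1 := hb (WithLp.toLp 2 v)
  have h2 : Matrix.toEuclideanLin b (WithLp.toLp 2 v) = 0 := by
    rw [Matrix.toLpLin_toLp, Matrix.toLin'_apply, hbv]; rfl
  rw [h2, inner_zero_left] at h1
  have h3 : 0 < ‖(WithLp.toLp 2 v : Ed d)‖ := by
    rw [norm_pos_iff]
    intro h0
    exact hv (by simpa using h0)
  have : 0 < k * ‖(WithLp.toLp 2 v : Ed d)‖ ^ 2 := by positivity
  linarith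

theorem Matrix.contDiff_det {d : ℕ} :
    ContDiff ℝ 1 (fun b : Matrix (Fin d) (Fin d) ℝ => b.det) := by
  simp only [Matrix.det_apply]
  refine ContDiff.sum fun σ _ => ContDiff.const_smul _ (contDiff_prod fun i _ => ?_)
  exact (LinearMap.toContinuousLinearMap
    (Matrix.entryLinearMap ℝ ℝ (σ i) i : Matrix (Fin d) (Fin d) ℝ →ₗ[ℝ] ℝ)).contDiff

/-- On bounded, uniformly coercive matrices, `det ^ s` is bounded and Lipschitz. -/
theorem exists_det_rpow_bound_lipschitz (d : ℕ) {K k : ℝ} (hk : 0 < k) (s : ℝ) :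
    ∃ M L : ℝ, 0 ≤ M ∧ 0 ≤ L ∧ ∀ b b' : Matrix (Fin d) (Fin d) ℝ,
      opN b ≤ K → opN b' ≤ K →
      (∀ ξ : Ed d, k * ‖ξ‖ ^ 2 ≤ ⟪Matrix.toEuclideanLin b ξ, ξ⟫) →
      (∀ ξ : Ed d, k * ‖ξ‖ ^ 2 ≤ ⟪Matrix.toEuclideanLin b' ξ, ξ⟫) →
      |b.det ^ s| ≤ M ∧ |b.det ^ s - b'.det ^ s| ≤ L * opN (b - b') := by
  let φ (ξ : Ed d) : Matrix (Fin d) (Fin d) ℝ →ₗ[ℝ] ℝ :=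
    (innerₗ (Ed d) ξ) ∘ₗ (LinearMap.applyₗ ξ) ∘ₗ (Matrix.toEuclideanLin).toLinearMap
  have hφ (ξ : Ed d) (b) : φ ξ b = ⟪Matrix.toEuclideanLin b ξ, ξ⟫ := by
    simp only [φ, LinearMap.comp_apply, innerₗ_apply_apply]
    exact real_inner_comm _ _
  let S : Set (Matrix (Fin d) (Fin d) ℝ) :=
    Metric.closedBall 0 K ∩ ⋂ ξ : Ed d, {b | k * ‖ξ‖ ^ 2 ≤ φ ξ b}
  have hconv : Convex ℝ S := (convex_closedBall _ _).inter
    (convex_iInter fun ξ => convex_halfSpace_ge (φ ξ).isLinear _)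
  have : ProperSpace (Matrix (Fin d) (Fin d) ℝ) := FiniteDimensional.proper_real _
  have hcomp : IsCompact S := (isCompact_closedBall _ _).inter_right
    (isClosed_iInter fun ξ =>
      isClosed_le continuous_const (φ ξ).continuous_of_finiteDimensional)
  have hmem (b) (h1 : opN b ≤ K)
      (h2 : ∀ ξ : Ed d, k * ‖ξ‖ ^ 2 ≤ ⟪Matrix.toEuclideanLin b ξ, ξ⟫) : b ∈ S := by
    refine ⟨?_, Set.mem_iInter.mpr fun ξ => ?_⟩
    · rw [mem_closedBall_zero_iff, Matrix.l2_opNorm_eq_opN]; exact h1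
    · rw [Set.mem_ofPred_eq, hφ]; exact h2 ξ
  have hdet : ∀ b ∈ S, b.det ≠ 0 := fun b hb =>
    Matrix.det_ne_zero_of_coercive hk fun ξ => by
      rw [← hφ]; exact Set.mem_iInter.mp hb.2 ξ
  have hcd : ContDiffOn ℝ 1 (fun b : Matrix (Fin d) (Fin d) ℝ => b.det ^ s) S :=
    Matrix.contDiff_det.contDiffOn.rpow_const_of_ne hdet
  obtain ⟨L, hL⟩ := hcd.exists_lipschitzOnWith one_ne_zero hconv hcomp
  obtain ⟨M, hM⟩ := hcomp.exists_bound_of_continuousOn hcd.continuousOn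
  refine ⟨max M 0, L, le_max_right _ _, L.2, fun b b' h1 h1' h2 h2' => ⟨?_, ?_⟩⟩
  · exact (hM b (hmem b h1 h2)).trans (le_max_left _ _)
  · have := hL.dist_le_mul b (hmem b h1 h2) b' (hmem b' h1' h2')
    rwa [Real.dist_eq, dist_eq_norm, Matrix.l2_opNorm_eq_opN] at this

end Normalizer

section Operator

variable {E : Type*} [NormedAddCommGroup E] [InnerProductSpace ℝ E]

theorem norm_sq_le_of_symmetric_of_inner_le {B : E →L[ℝ] E}
    (hs : ∀ v w, ⟪B v, w⟫ = ⟪v, B w⟫) {M : ℝ} (hM : 0 < M) (h0 : ∀ v, 0 ≤ ⟪B v, v⟫)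
    (h1 : ∀ v, ⟪B v, v⟫ ≤ M * ‖v‖ ^ 2) (w : E) : ‖B w‖ ^ 2 ≤ M * ⟪B w, w⟫ := by
  have h := h0 (w - M⁻¹ • B w)
  have h2 := h1 (B w)
  have e : ⟪B (w - M⁻¹ • B w), w - M⁻¹ • B w⟫ =
      ⟪B w, w⟫ - 2 * M⁻¹ * ‖B w‖ ^ 2 + M⁻¹ ^ 2 * ⟪B (B w), B w⟫ := by
    simp only [map_sub, map_smul, inner_sub_left, inner_sub_right, real_inner_smul_left,
      real_inner_smul_right, hs (B w) w, real_inner_self_eq_norm_sq]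
    ring
  rw [e] at h
  have h3 : M⁻¹ ^ 2 * ⟪B (B w), B w⟫ ≤ M⁻¹ ^ 2 * (M * ‖B w‖ ^ 2) := by gcongr
  have h4 : M⁻¹ ^ 2 * (M * ‖B w‖ ^ 2) = M⁻¹ * ‖B w‖ ^ 2 := by field_simp
  have h5 : M⁻¹ * ‖B w‖ ^ 2 ≤ ⟪B w, w⟫ := by linarith
  rwa [inv_mul_le_iff₀ hM] at h5

theorem opNorm_le_of_symmetric_of_inner_le {B : E →L[ℝ] E}
    (hs : ∀ v w, ⟪B v, w⟫ = ⟪v, B w⟫) {M : ℝ} (hM : 0 < M) (h0 : ∀ v, 0 ≤ ⟪B v, v⟫)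
    (h1 : ∀ v, ⟪B v, v⟫ ≤ M * ‖v‖ ^ 2) : ‖B‖ ≤ M := by
  refine B.opNorm_le_bound hM.le fun w => ?_
  have h2 := norm_sq_le_of_symmetric_of_inner_le hs hM h0 h1 w
  refine le_of_sq_le_sq ?_ (by positivity)
  calc ‖B w‖ ^ 2 ≤ M * (M * ‖w‖ ^ 2) := h2.trans (by gcongr; exact h1 w)
    _ = (M * ‖w‖) ^ 2 := by ring

theorem opNorm_rightInverse_le {A B : E →L[ℝ] E} (hBA : ∀ z, B (A z) = z) {m : ℝ} (hm : 0 < m)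
    (h : ∀ v, m * ‖v‖ ^ 2 ≤ ⟪B v, v⟫) : ‖A‖ ≤ m⁻¹ := by
  refine A.opNorm_le_bound (by positivity) fun z => ?_
  have h1 := h (A z)
  rw [hBA] at h1
  have h2 := real_inner_le_norm z (A z)
  rw [inv_mul_eq_div, le_div_iff₀ hm]
  rcases (norm_nonneg (A z)).eq_or_lt with h0 | h0
  · rw [← h0]; simp
  · refine le_of_mul_le_mul_right ?_ h0
    nlinarith

theorem hasGradientAt_gaussian [CompleteSpace E] {A : E →L[ℝ] E} (hs : ∀ v w, ⟪A v, w⟫ = ⟪v, A w⟫) (C : ℝ)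
    (y x : E) :
    HasGradientAt (fun w => C * Real.exp (-(1 / 2) * ⟪A (y - w), y - w⟫))
      ((C * Real.exp (-(1 / 2) * ⟪A (y - x), y - x⟫)) • A (y - x)) x := by
  have h1 : HasFDerivAt (fun w => y - w) (-ContinuousLinearMap.id ℝ E) x :=
    (hasFDerivAt_id x).const_sub y
  have h2 : HasFDerivAt (fun w => A (y - w)) (A ∘L (-ContinuousLinearMap.id ℝ E)) x :=
    A.hasFDerivAt.comp x h1
  have h3 := (((h2.inner ℝ h1).const_mul (-(1 / 2))).exp).const_mul C
  rw [hasGradientAt_iff_hasFDerivAt]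
  refine h3.congr_fderiv ?_
  ext h
  have e : ⟪A h, y - x⟫ = ⟪A (y - x), h⟫ := by rw [hs, real_inner_comm]
  simp [fderivInnerCLM_apply, -map_sub, e]
  ring

theorem hasFDerivAt_gaussian_gradient [CompleteSpace E] {A : E →L[ℝ] E}
    (hs : ∀ v w, ⟪A v, w⟫ = ⟪v, A w⟫) (C : ℝ) (y x : E) :
    HasFDerivAt (fun w => (C * Real.exp (-(1 / 2) * ⟪A (y - w), y - w⟫)) • A (y - w))
      ((C * Real.exp (-(1 / 2) * ⟪A (y - x), y - x⟫)) •
        ((innerSL ℝ (A (y - x))).smulRight (A (y - x)) - A)) x := by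
  have h1 : HasFDerivAt (fun w => y - w) (-ContinuousLinearMap.id ℝ E) x :=
    (hasFDerivAt_id x).const_sub y
  have h2 : HasFDerivAt (fun w => A (y - w)) (A ∘L (-ContinuousLinearMap.id ℝ E)) x :=
    A.hasFDerivAt.comp x h1
  refine ((hasGradientAt_gaussian hs C y x).hasFDerivAt.smul h2).congr_fderiv ?_
  ext h
  simp [-map_sub]
  module

theorem norm_smul_sub_smul_le {F : Type*} [SeminormedAddCommGroup F] [NormedSpace ℝ F]
    (p p' : ℝ) (u u' : F) : ‖p • u - p' • u'‖ ≤ |p| * ‖u - u'‖ + |p - p'| * ‖u'‖ := by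
  have : p • u - p' • u' = p • (u - u') + (p - p') • u' := by module
  rw [this]
  exact (norm_add_le _ _).trans_eq (by rw [norm_smul, norm_smul]; rfl)

theorem norm_rankOne_sub_rankOne_le (u v : E) :
    ‖(innerSL ℝ u).smulRight u - (innerSL ℝ v).smulRight v‖ ≤ (‖u‖ + ‖v‖) * ‖u - v‖ := by
  have : (innerSL ℝ u).smulRight u - (innerSL ℝ v).smulRight v =
      (innerSL ℝ (u - v)).smulRight u + (innerSL ℝ v).smulRight (u - v) := by
    ext h
    simp
    module
  rw [this]
  refine (norm_add_le _ _).trans_eq ?_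
  rw [ContinuousLinearMap.norm_smulRight_apply, ContinuousLinearMap.norm_smulRight_apply,
    innerSL_apply_norm, innerSL_apply_norm]
  ring

theorem norm_gaussian_gradient_sub_le {A A' : E →L[ℝ] E} {α δ P D p p' : ℝ}
    (hA' : ‖A'‖ ≤ α) (hδ : ‖A - A'‖ ≤ δ) (hp : |p| ≤ P) (hD : |p - p'| ≤ D) (z : E) :
    ‖p • A z - p' • A' z‖ ≤ P * (δ * ‖z‖) + D * (α * ‖z‖) := by
  have hP0 := (abs_nonneg _).trans hp
  have hD0 := (abs_nonneg _).trans hD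
  refine (norm_smul_sub_smul_le p p' (A z) (A' z)).trans ?_
  gcongr
  · exact (A - A').le_of_opNorm_le hδ z
  · exact A'.le_of_opNorm_le hA' z

theorem norm_gaussian_hessian_sub_le {A A' : E →L[ℝ] E} {α δ P D p p' : ℝ}
    (hA : ‖A‖ ≤ α) (hA' : ‖A'‖ ≤ α) (hδ : ‖A - A'‖ ≤ δ) (hp : |p| ≤ P) (hD : |p - p'| ≤ D)
    (z : E) :
    ‖p • ((innerSL ℝ (A z)).smulRight (A z) - A) -
        p' • ((innerSL ℝ (A' z)).smulRight (A' z) - A')‖ ≤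
      P * (2 * α * δ * ‖z‖ ^ 2 + δ) + D * (α ^ 2 * ‖z‖ ^ 2 + α) := by
  have hP0 := (abs_nonneg _).trans hp
  have hD0 := (abs_nonneg _).trans hD
  have hα0 := (norm_nonneg _).trans hA
  have h1 := A.le_of_opNorm_le hA z
  have h2 := A'.le_of_opNorm_le hA' z
  have h3 : ‖A z - A' z‖ ≤ δ * ‖z‖ := (A - A').le_of_opNorm_le hδ z
  refine (norm_smul_sub_smul_le p p' _ _).trans ?_
  gcongr
  · rw [sub_sub_sub_comm]
    refine (norm_sub_le _ _).trans (add_le_add ?_ hδ)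
    calc _ ≤ (‖A z‖ + ‖A' z‖) * ‖A z - A' z‖ := norm_rankOne_sub_rankOne_le _ _
      _ ≤ (α * ‖z‖ + α * ‖z‖) * (δ * ‖z‖) := by gcongr
      _ = _ := by ring
  · refine (norm_sub_le _ _).trans (add_le_add ?_ hA')
    rw [ContinuousLinearMap.norm_smulRight_apply, innerSL_apply_norm]
    calc ‖A' z‖ * ‖A' z‖ ≤ (α * ‖z‖) * (α * ‖z‖) := by gcongr
      _ = _ := by ring

end Operator

section Scalar

theorem abs_exp_neg_sub_exp_neg_le {s s' m : ℝ} (hs : m ≤ s) (hs' : m ≤ s') :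
    |Real.exp (-s) - Real.exp (-s')| ≤ |s - s'| * Real.exp (-m) := by
  wlog h : s ≤ s' generalizing s s'
  · rw [abs_sub_comm, abs_sub_comm s]
    exact this hs' hs (le_of_not_ge h)
  have h1 : Real.exp (-s') = Real.exp (-s) * Real.exp (-(s' - s)) := by
    rw [← Real.exp_add]; ring_nf
  have h2 := Real.add_one_le_exp (-(s' - s))
  have h3 : Real.exp (-s) ≤ Real.exp (-m) := Real.exp_le_exp.mpr (by linarith)
  rw [abs_of_nonneg (sub_nonneg.mpr (Real.exp_le_exp.mpr (by linarith))),
    abs_of_nonpos (by linarith), h1]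
  calc Real.exp (-s) - Real.exp (-s) * Real.exp (-(s' - s))
      = Real.exp (-s) * (1 - Real.exp (-(s' - s))) := by ring
    _ ≤ Real.exp (-s) * (s' - s) := mul_le_mul_of_nonneg_left (by linarith) (Real.exp_pos _).le
    _ ≤ Real.exp (-m) * (s' - s) := mul_le_mul_of_nonneg_right h3 (by linarith)
    _ = _ := by ring

theorem one_add_pow_four_mul_exp_le {K : ℝ} (hK : 0 < K) (u : ℝ) :
    (1 + u ^ 4) * Real.exp (-u ^ 2 / (2 * K)) ≤
      (1 + 32 * K ^ 2) * Real.exp (-u ^ 2 / (4 * K)) := by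
  have h : Real.exp (-u ^ 2 / (2 * K)) =
      Real.exp (-u ^ 2 / (4 * K)) * Real.exp (-(u ^ 2 / (4 * K))) := by
    rw [← Real.exp_add]; congr 1; field_simp; ring
  have hs : 0 ≤ u ^ 2 / (4 * K) := by positivity
  have h1 := Real.quadratic_le_exp_of_nonneg hs
  have h2 : u ^ 4 = 16 * K ^ 2 * (u ^ 2 / (4 * K)) ^ 2 := by field_simp; ring
  have h3 : 1 + u ^ 4 ≤ (1 + 32 * K ^ 2) * Real.exp (u ^ 2 / (4 * K)) := by
    rw [h2]
    nlinarith [mul_le_mul_of_nonneg_left h1 (sq_nonneg K), mul_nonneg (sq_nonneg K) hs,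
      sq_nonneg K]
  rw [h]
  calc _ ≤ ((1 + 32 * K ^ 2) * Real.exp (u ^ 2 / (4 * K))) *
        (Real.exp (-u ^ 2 / (4 * K)) * Real.exp (-(u ^ 2 / (4 * K)))) := by gcongr
    _ = (1 + 32 * K ^ 2) * Real.exp (-u ^ 2 / (4 * K)) *
        (Real.exp (u ^ 2 / (4 * K)) * Real.exp (-(u ^ 2 / (4 * K)))) := by ring
    _ = _ := by rw [← Real.exp_add]; simp

theorem gaussian_polynomial_le {K M L u : ℝ} (hK : 0 < K) (hM : 0 ≤ M) (hL : 0 ≤ L) :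
    M * K ^ 3 * (u + 2 * K * u ^ 2 + 1) +
        (L * K + M * K ^ 3 / 2 * u ^ 2) * (K * u + K ^ 2 * u ^ 2 + K) ≤
      (M * K ^ 3 * (2 + 2 * K) + (L * K + M * K ^ 3 / 2) * (2 * K + K ^ 2)) * (1 + u ^ 4) := by
  have h2 : u ^ 2 ≤ 1 + u ^ 4 := by nlinarith [sq_nonneg (u ^ 2 - 1)]
  have h1 : u ≤ 1 + u ^ 4 := by nlinarith [sq_nonneg (u ^ 2 - 1), sq_nonneg (u - 1)]
  have h3 : u ^ 3 ≤ 1 + u ^ 4 := by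
    nlinarith [sq_nonneg (u ^ 2 - u), sq_nonneg (u ^ 2 - 1)]
  have h0 : 1 ≤ 1 + u ^ 4 := by nlinarith [sq_nonneg (u ^ 2)]
  have h4 : u ^ 4 ≤ 1 + u ^ 4 := by linarith
  calc _ = M * K ^ 3 * (u + 2 * K * u ^ 2 + 1) + L * K * (K * u + K ^ 2 * u ^ 2 + K * 1) +
        M * K ^ 3 / 2 * (K * u ^ 3 + K ^ 2 * u ^ 4 + K * u ^ 2) := by ring
    _ ≤ M * K ^ 3 * ((1 + u ^ 4) + 2 * K * (1 + u ^ 4) + (1 + u ^ 4)) +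
        L * K * (K * (1 + u ^ 4) + K ^ 2 * (1 + u ^ 4) + K * (1 + u ^ 4)) +
        M * K ^ 3 / 2 * (K * (1 + u ^ 4) + K ^ 2 * (1 + u ^ 4) + K * (1 + u ^ 4)) := by
      gcongr
    _ = _ := by ring

end Scalar

section Elliptic

variable {d : ℕ} {K τ : ℝ} {a a' : Matrix (Fin d) (Fin d) ℝ}

/-- The inverse of a matrix as an operator on Euclidean space. -/
def invOp (a : Matrix (Fin d) (Fin d) ℝ) : Ed d →L[ℝ] Ed d :=
  LinearMap.toContinuousLinearMap (Matrix.toEuclideanLin a⁻¹)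

theorem toEuclideanLin_invOp (ha : a.PosDef) (z : Ed d) :
    Matrix.toEuclideanLin a (invOp a z) = z := by
  have h : IsUnit a.det := (Matrix.isUnit_iff_isUnit_det _).mp ha.isUnit
  simp [invOp, Matrix.toLpLin_apply, Matrix.mulVec_mulVec, Matrix.mul_nonsing_inv _ h]

theorem invOp_toEuclideanLin (ha : a.PosDef) (z : Ed d) :
    invOp a (Matrix.toEuclideanLin a z) = z := by
  have h : IsUnit a.det := (Matrix.isUnit_iff_isUnit_det _).mp ha.isUnit
  simp [invOp, Matrix.toLpLin_apply, Matrix.mulVec_mulVec, Matrix.nonsing_inv_mul _ h]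

theorem inner_toEuclideanLin_comm_s6 (ha : a.PosDef) (v w : Ed d) :
    ⟪Matrix.toEuclideanLin a v, w⟫ = ⟪v, Matrix.toEuclideanLin a w⟫ :=
  Matrix.isSymmetric_toEuclideanLin_iff.mpr ha.isHermitian v w

theorem inner_invOp_comm (ha : a.PosDef) (v w : Ed d) : ⟪invOp a v, w⟫ = ⟪v, invOp a w⟫ :=
  Matrix.isSymmetric_toEuclideanLin_iff.mpr ha.inv.isHermitian v w

theorem IsElliptic.inner_nonneg (hK : 0 < K) (hτ : 0 < τ) (h : IsElliptic K τ a) (v : Ed d) :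
    0 ≤ ⟪Matrix.toEuclideanLin a v, v⟫ :=
  le_trans (by positivity) (h v).1

theorem IsElliptic.opN_le (hK : 0 < K) (hτ : 0 < τ) (ha : a.PosDef) (h : IsElliptic K τ a) :
    opN a ≤ K * τ :=
  opNorm_le_of_symmetric_of_inner_le
    (B := LinearMap.toContinuousLinearMap (Matrix.toEuclideanLin a))
    (inner_toEuclideanLin_comm_s6 ha) (by positivity) (h.inner_nonneg hK hτ) fun v => (h v).2

theorem IsElliptic.norm_invOp_le (hK : 0 < K) (hτ : 0 < τ) (ha : a.PosDef)
    (h : IsElliptic K τ a) : ‖invOp a‖ ≤ K / τ := by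
  rw [← inv_div]
  exact opNorm_rightInverse_le
    (B := LinearMap.toContinuousLinearMap (Matrix.toEuclideanLin a))
    (toEuclideanLin_invOp ha) (by positivity) fun v => (h v).1

theorem IsElliptic.le_inner_invOp (hK : 0 < K) (hτ : 0 < τ) (ha : a.PosDef)
    (h : IsElliptic K τ a) (z : Ed d) : ‖z‖ ^ 2 / (K * τ) ≤ ⟪invOp a z, z⟫ := by
  have h1 := norm_sq_le_of_symmetric_of_inner_le
    (B := LinearMap.toContinuousLinearMap (Matrix.toEuclideanLin a))
    (inner_toEuclideanLin_comm_s6 ha) (M := K * τ) (by positivity) (h.inner_nonneg hK hτ)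
    (fun v => (h v).2) (invOp a z)
  rw [LinearMap.coe_toContinuousLinearMap', toEuclideanLin_invOp ha] at h1
  rw [div_le_iff₀ (by positivity), real_inner_comm]
  linarith

theorem IsElliptic.norm_invOp_sub_le (hK : 0 < K) (hτ : 0 < τ) (ha : a.PosDef)
    (ha' : a'.PosDef) (h : IsElliptic K τ a) (h' : IsElliptic K τ a') {η : ℝ} (hη : 0 ≤ η)
    (hd : opN (a - a') ≤ K * τ * η) : ‖invOp a - invOp a'‖ ≤ K ^ 3 * η / τ := by
  have e : invOp a - invOp a' = -(invOp a ∘L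
      LinearMap.toContinuousLinearMap (Matrix.toEuclideanLin (a - a')) ∘L invOp a') := by
    ext1 z
    simp [toEuclideanLin_invOp ha', invOp_toEuclideanLin ha]
  rw [e, norm_neg]
  calc _ ≤ ‖invOp a‖ * (opN (a - a') * ‖invOp a'‖) :=
        (ContinuousLinearMap.opNorm_comp_le _ _).trans
          (by gcongr; exact ContinuousLinearMap.opNorm_comp_le _ _)
    _ ≤ (K / τ) * ((K * τ * η) * (K / τ)) := by
        gcongr
        · exact mul_nonneg (norm_nonneg _) (norm_nonneg _)
        · exact h.norm_invOp_le hK hτ ha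
        · exact h'.norm_invOp_le hK hτ ha'
    _ = _ := by field_simp

theorem opN_smul {r : ℝ} (hr : 0 ≤ r) (b : Matrix (Fin d) (Fin d) ℝ) :
    opN (r • b) = r * opN b := by
  simp [opN, norm_smul, abs_of_nonneg hr]

theorem gradP_eq_s6 (ha : a.PosDef) (x y : Ed d) :
    gradP d a y x = pG d a x y • invOp a (y - x) :=
  (hasGradientAt_gaussian (inner_invOp_comm ha) _ y x).gradient

theorem hessP_eq (ha : a.PosDef) (x y : Ed d) :
    hessP d a y x = pG d a x y •
      ((innerSL ℝ (invOp a (y - x))).smulRight (invOp a (y - x)) - invOp a) := by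
  have : gradP d a y = fun w => pG d a w y • invOp a (y - w) :=
    funext fun w => gradP_eq_s6 ha w y
  rw [hessP, this]
  exact (hasFDerivAt_gaussian_gradient (inner_invOp_comm ha) _ y x).fderiv

theorem det_rpow_eq (hτ : 0 < τ) (ha : a.PosDef) :
    a.det ^ (-(1 : ℝ) / 2) = τ ^ (-(d : ℝ) / 2) * (τ⁻¹ • a).det ^ (-(1 : ℝ) / 2) := by
  have h1 : a.det = τ ^ d * (τ⁻¹ • a).det := by
    rw [Matrix.det_smul, Fintype.card_fin, ← mul_assoc, ← mul_pow, mul_inv_cancel₀ hτ.ne',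
      one_pow, one_mul]
  have h2 : 0 ≤ (τ⁻¹ • a).det := by
    rw [Matrix.det_smul]; have := ha.det_pos; positivity
  rw [h1, Real.mul_rpow (by positivity) h2, ← Real.rpow_natCast, ← Real.rpow_mul hτ.le]
  congr 2
  ring

theorem pG_eq (hτ : 0 < τ) (ha : a.PosDef) (x y : Ed d) :
    pG d a x y = (2 * Real.pi) ^ (-(d : ℝ) / 2) * τ ^ (-(d : ℝ) / 2) *
      ((τ⁻¹ • a).det ^ (-(1 : ℝ) / 2) * Real.exp (-(1 / 2 * ⟪invOp a (y - x), y - x⟫))) := by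
  rw [pG, det_rpow_eq hτ ha, ← neg_mul]
  simp only [invOp, LinearMap.coe_toContinuousLinearMap']
  ring

theorem gaussK_eq (hK : 0 < K) (hτ : 0 < τ) (x y : Ed d) :
    (2 * Real.pi) ^ (-(d : ℝ) / 2) * τ ^ (-(d : ℝ) / 2) *
      Real.exp (-‖y - x‖ ^ 2 / (4 * K * τ)) = (2 * K) ^ ((d : ℝ) / 2) * gaussK d K τ x y := by
  have h : 4 * K * Real.pi * τ = 2 * K * (2 * Real.pi * τ) := by ring
  rw [gaussK, h, Real.mul_rpow (x := 2 * K) (by positivity) (by positivity),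
    Real.mul_rpow (x := 2 * Real.pi) (by positivity) hτ.le, neg_div,
    Real.rpow_neg (x := 2 * K) (by positivity)]
  have : (2 * K) ^ ((d : ℝ) / 2) ≠ 0 := by positivity
  field_simp

theorem IsElliptic.coercive_inv_smul (hτ : 0 < τ) (h : IsElliptic K τ a) (ξ : Ed d) :
    K⁻¹ * ‖ξ‖ ^ 2 ≤ ⟪Matrix.toEuclideanLin (τ⁻¹ • a) ξ, ξ⟫ := by
  rw [map_smul, LinearMap.smul_apply, real_inner_smul_left, le_inv_mul_iff₀ hτ]
  refine le_trans (le_of_eq ?_) (h ξ).1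
  ring

theorem IsElliptic.opN_inv_smul_le (hK : 0 < K) (hτ : 0 < τ) (ha : a.PosDef)
    (h : IsElliptic K τ a) : opN (τ⁻¹ • a) ≤ K := by
  rw [opN_smul (by positivity), inv_mul_le_iff₀ hτ]
  linarith [h.opN_le hK hτ ha]

/-- Size and stability of the Gaussian density itself. -/
theorem exists_abs_pG_le_and_abs_pG_sub_le (d : ℕ) {K : ℝ} (hK : 0 < K) :
    ∃ M L : ℝ, 0 ≤ M ∧ 0 ≤ L ∧ ∀ τ η : ℝ, 0 < τ → 0 ≤ η →
      ∀ a a' : Matrix (Fin d) (Fin d) ℝ, a.PosDef → a'.PosDef →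
        IsElliptic K τ a → IsElliptic K τ a' → opN (a - a') ≤ K * τ * η → ∀ x y : Ed d,
          |pG d a x y| ≤ (2 * Real.pi) ^ (-(d : ℝ) / 2) * τ ^ (-(d : ℝ) / 2) *
            (M * Real.exp (-(‖y - x‖ ^ 2 / (2 * K * τ)))) ∧
          |pG d a x y - pG d a' x y| ≤ (2 * Real.pi) ^ (-(d : ℝ) / 2) * τ ^ (-(d : ℝ) / 2) *
            (η * (L * K + M * K ^ 3 / 2 * (‖y - x‖ ^ 2 / τ)) *
              Real.exp (-(‖y - x‖ ^ 2 / (2 * K * τ)))) := by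
  obtain ⟨M, L, hM, hL, hML⟩ :=
    exists_det_rpow_bound_lipschitz d (K := K) (inv_pos.mpr hK) (-(1 : ℝ) / 2)
  refine ⟨M, L, hM, hL, fun τ η hτ hη a a' ha ha' h h' hd x y => ?_⟩
  obtain ⟨h1, h2⟩ := hML (τ⁻¹ • a) (τ⁻¹ • a') (h.opN_inv_smul_le hK hτ ha)
    (h'.opN_inv_smul_le hK hτ ha') (h.coercive_inv_smul hτ) (h'.coercive_inv_smul hτ)
  have h3 : L * opN (τ⁻¹ • a - τ⁻¹ • a') ≤ η * (L * K) := by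
    rw [← smul_sub, opN_smul (by positivity)]
    calc L * (τ⁻¹ * opN (a - a')) ≤ L * (τ⁻¹ * (K * τ * η)) := by gcongr
      _ = _ := by field_simp
  have hN : 0 < (2 * Real.pi) ^ (-(d : ℝ) / 2) * τ ^ (-(d : ℝ) / 2) := by positivity
  rw [pG_eq hτ ha, pG_eq hτ ha', ← mul_sub]
  set N := (2 * Real.pi) ^ (-(d : ℝ) / 2) * τ ^ (-(d : ℝ) / 2)
  rw [abs_mul, abs_mul N, abs_of_pos hN]
  set z := y - x
  have e : ‖z‖ ^ 2 / (2 * K * τ) = 1 / 2 * (‖z‖ ^ 2 / (K * τ)) := by field_simp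
  have hm : ‖z‖ ^ 2 / (2 * K * τ) ≤ 1 / 2 * ⟪invOp a z, z⟫ := by
    rw [e]; gcongr; exact h.le_inner_invOp hK hτ ha z
  have hm' : ‖z‖ ^ 2 / (2 * K * τ) ≤ 1 / 2 * ⟪invOp a' z, z⟫ := by
    rw [e]; gcongr; exact h'.le_inner_invOp hK hτ ha' z
  have hexp := abs_exp_neg_sub_exp_neg_le hm hm'
  have hdiff : |1 / 2 * ⟪invOp a z, z⟫ - 1 / 2 * ⟪invOp a' z, z⟫| ≤
      η * (K ^ 3 / 2 * (‖z‖ ^ 2 / τ)) := by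
    have e2 : 1 / 2 * ⟪invOp a z, z⟫ - 1 / 2 * ⟪invOp a' z, z⟫ =
        1 / 2 * ⟪(invOp a - invOp a') z, z⟫ := by
      rw [sub_apply, inner_sub_left]; ring
    rw [e2, abs_mul, abs_of_pos (by norm_num : (0 : ℝ) < 1 / 2)]
    calc _ ≤ 1 / 2 * ((K ^ 3 * η / τ * ‖z‖) * ‖z‖) := by
          gcongr
          refine (abs_real_inner_le_norm _ _).trans ?_
          gcongr
          exact ContinuousLinearMap.le_of_opNorm_le _
            (h.norm_invOp_sub_le hK hτ ha ha' h' hη hd) z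
      _ = _ := by ring
  constructor
  · gcongr ?_ * ?_
    rw [abs_mul, Real.abs_exp]
    gcongr
  · gcongr ?_ * ?_
    refine (norm_smul_sub_smul_le (F := ℝ) _ _ _ _).trans ?_
    rw [Real.norm_eq_abs, Real.norm_eq_abs, Real.abs_exp]
    calc _ ≤ M * (η * (K ^ 3 / 2 * (‖z‖ ^ 2 / τ)) * Real.exp (-(‖z‖ ^ 2 / (2 * K * τ)))) +
          (η * (L * K)) * Real.exp (-(‖z‖ ^ 2 / (2 * K * τ))) := by
          gcongr
          · exact hexp.trans (by gcongr)
          · exact h2.trans h3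
      _ = _ := by ring

end Elliptic

/-- stability of the derivatives of the Gaussian density in its
covariance matrix: `√τ |∇p_a − ∇p_{a'}| + τ ‖∇²p_a − ∇²p_{a'}‖ ≤ c η p̃^{K,τ}`. -/
theorem stmt6 (d : ℕ) (hd : 1 ≤ d) (K : ℝ) (hK : 1 ≤ K) :
    ∃ c > 0, ∀ τ η : ℝ, 0 < τ → 0 ≤ η →
      ∀ a a' : Matrix (Fin d) (Fin d) ℝ,
        a.IsSymm → a.PosDef → a'.IsSymm → a'.PosDef →
        IsElliptic K τ a → IsElliptic K τ a' →
        opN (a - a') ≤ K * τ * η → ∀ x y : Ed d,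
          Real.sqrt τ * ‖gradP d a y x - gradP d a' y x‖ +
              τ * ‖hessP d a y x - hessP d a' y x‖ ≤
            c * η * gaussK d K τ x y := by
  have hK0 : 0 < K := by linarith
  obtain ⟨M, L, hM, hL, hML⟩ := exists_abs_pG_le_and_abs_pG_sub_le d hK0
  set Q := M * K ^ 3 * (2 + 2 * K) + (L * K + M * K ^ 3 / 2) * (2 * K + K ^ 2) with hQ
  have hQ0 : 0 ≤ Q := by positivity
  refine ⟨(2 * K) ^ ((d : ℝ) / 2) * (Q * (1 + 32 * K ^ 2)) + 1, by positivity, ?_⟩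
  intro τ η hτ hη a a' _ ha _ ha' h h' hdiff x y
  obtain ⟨h1, h2⟩ := hML τ η hτ hη a a' ha ha' h h' hdiff x y
  have hA := h.norm_invOp_le hK0 hτ ha
  have hA' := h'.norm_invOp_le hK0 hτ ha'
  have hδ := h.norm_invOp_sub_le hK0 hτ ha ha' h' hη hdiff
  have hg := norm_gaussian_gradient_sub_le hA' hδ h1 h2 (y - x)
  have hh := norm_gaussian_hessian_sub_le hA hA' hδ h1 h2 (y - x)
  rw [← gradP_eq_s6 ha, ← gradP_eq_s6 ha'] at hg
  rw [← hessP_eq ha, ← hessP_eq ha'] at hh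
  have hN : 0 < (2 * Real.pi) ^ (-(d : ℝ) / 2) * τ ^ (-(d : ℝ) / 2) := by positivity
  have hG : 0 ≤ gaussK d K τ x y := by unfold gaussK; positivity
  have hGe := gaussK_eq (d := d) hK0 hτ x y
  set N := (2 * Real.pi) ^ (-(d : ℝ) / 2) * τ ^ (-(d : ℝ) / 2)
  obtain ⟨t, ht, rfl⟩ : ∃ t : ℝ, 0 < t ∧ t ^ 2 = τ :=
    ⟨Real.sqrt τ, Real.sqrt_pos.mpr hτ, Real.sq_sqrt hτ.le⟩
  obtain ⟨u, hu, hut⟩ : ∃ u : ℝ, 0 ≤ u ∧ ‖y - x‖ = t * u :=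
    ⟨‖y - x‖ / t, by positivity, by field_simp⟩
  rw [hut] at hg hh hGe
  have e1 : -((t * u) ^ 2 / (2 * K * t ^ 2)) = -u ^ 2 / (2 * K) := by field_simp
  have e2 : -(t * u) ^ 2 / (4 * K * t ^ 2) = -u ^ 2 / (4 * K) := by field_simp
  have e3 : (t * u) ^ 2 / t ^ 2 = u ^ 2 := by field_simp
  rw [e1, e3] at hg hh
  rw [e2] at hGe
  rw [Real.sqrt_sq ht.le]
  calc _ ≤ _ := add_le_add (mul_le_mul_of_nonneg_left hg ht.le)
        (mul_le_mul_of_nonneg_left hh (sq_nonneg t))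
    _ = N * η * (M * K ^ 3 * (u + 2 * K * u ^ 2 + 1) +
        (L * K + M * K ^ 3 / 2 * u ^ 2) * (K * u + K ^ 2 * u ^ 2 + K)) *
          Real.exp (-u ^ 2 / (2 * K)) := by
        field_simp
        ring
    _ ≤ N * η * (Q * (1 + u ^ 4)) * Real.exp (-u ^ 2 / (2 * K)) := by
        gcongr
        exact gaussian_polynomial_le hK0 hM hL
    _ = N * η * Q * ((1 + u ^ 4) * Real.exp (-u ^ 2 / (2 * K))) := by ring
    _ ≤ N * η * Q * ((1 + 32 * K ^ 2) * Real.exp (-u ^ 2 / (4 * K))) := by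
        gcongr N * η * Q * ?_
        exact one_add_pow_four_mul_exp_le hK0 u
    _ = (2 * K) ^ ((d : ℝ) / 2) * (Q * (1 + 32 * K ^ 2)) * η * gaussK d K (t ^ 2) x y := by
        linear_combination η * Q * (1 + 32 * K ^ 2) * hGe
    _ ≤ _ := by
        gcongr
        linarith
end
end

section
/- Let d ≥ 1, T > 0, K > 0, and let (p,q) ∈ 𝒦 with δ := (1 − d/p − 2/q)/2. Then there exists a constant c > 0, depending only on T, d, p, q and K, such that for all 0 ≤ s < t ≤ T, every nonnegative measurable function g : [s,t]×ℝ^d → [0,∞) with ‖g‖_{L̃_p^q([s,t])} < ∞, and all x, y ∈ ℝ^d, one has ∫_s^t ∫_{ℝ^d} p̃^{K,r−s}(x,y') (r−s)^{-1/2} g(r,y') (t−r)^{-1/2} p̃^{2K,t−r}(y',y) dy' dr ≤ c (t−s)^{-1/2+δ} p̃^{2K,t−s}(x,y) ‖g‖_{L̃_p^q([s,t])}. -/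
open MeasureTheory Real Filter
open scoped ENNReal RealInnerProductSpace

noncomputable section

/-- Integrating the integrals over unit balls over all centres counts every point with the volume
of a unit ball. -/
theorem lintegral_lintegral_closedBall {d : ℕ} {f : Ed d → ℝ≥0∞} (hf : Measurable f) :
    ∫⁻ z, ∫⁻ y in Metric.closedBall z 1, f y =
      volume (Metric.closedBall (0 : Ed d) 1) * ∫⁻ y, f y := by
  have hS : MeasurableSet {w : Ed d × Ed d | dist w.2 w.1 ≤ 1} :=
    measurableSet_le (by fun_prop) (by fun_prop)
  have h1 : ∀ z : Ed d, ∫⁻ y in Metric.closedBall z 1, f y =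
      ∫⁻ y, {w : Ed d × Ed d | dist w.2 w.1 ≤ 1}.indicator (fun w => f w.2) (z, y) := by
    intro z
    rw [← lintegral_indicator Metric.isClosed_closedBall.measurableSet]
    rfl
  simp_rw [h1]
  have hm : Measurable (Function.uncurry fun z y : Ed d =>
      {w : Ed d × Ed d | dist w.2 w.1 ≤ 1}.indicator (fun w => f w.2) (z, y)) :=
    (hf.comp measurable_snd).indicator hS
  rw [lintegral_lintegral_swap hm.aemeasurable, mul_comm, ← lintegral_mul_const _ hf]
  refine lintegral_congr fun y => ?_
  have h2 : ∀ z : Ed d, {w : Ed d × Ed d | dist w.2 w.1 ≤ 1}.indicator (fun w => f w.2) (z, y) =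
      (Metric.closedBall y 1).indicator (fun _ => f y) z := by
    intro z
    simp [Set.indicator, dist_comm y z]
  simp_rw [h2]
  rw [lintegral_indicator Metric.isClosed_closedBall.measurableSet, setLIntegral_const,
    Measure.addHaar_closedBall_center]

theorem lintegral_exp_neg_mul_sq_norm {d : ℕ} {b : ℝ} (hb : 0 < b) (x : Ed d) :
    ∫⁻ y, ENNReal.ofReal (exp (-b * ‖y - x‖ ^ 2)) =
      ENNReal.ofReal ((π / b) ^ ((d : ℝ) / 2)) := by
  rw [lintegral_sub_right_eq_self (fun y : Ed d => ENNReal.ofReal (exp (-b * ‖y‖ ^ 2))) x]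
  have h := GaussianFourier.integral_rexp_neg_mul_sq_norm (V := Ed d) hb
  rw [finrank_euclideanSpace_fin] at h
  have hpos : 0 < (π / b) ^ ((d : ℝ) / 2) := by positivity
  rw [← h, ofReal_integral_eq_lintegral_ofReal]
  · by_contra hi
    rw [integral_undef hi] at h
    exact hpos.ne h
  · exact Eventually.of_forall fun _ => (exp_pos _).le

/-- Hölder's inequality against a Gaussian. -/
theorem setLIntegral_exp_mul_le {d : ℕ} {p p' b : ℝ} (hpp : p.HolderConjugate p') (hb : 0 < b)
    {h : Ed d → ℝ≥0∞} (hh : Measurable h) (x : Ed d) (S : Set (Ed d)) :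
    ∫⁻ y in S, ENNReal.ofReal (exp (-b * ‖y - x‖ ^ 2)) * h y ≤
      ENNReal.ofReal ((π / (p' * b)) ^ ((d : ℝ) / 2 / p')) * (∫⁻ y in S, h y ^ p) ^ (1 / p) := by
  have hp' : 0 < p' := hpp.symm.pos
  refine (ENNReal.lintegral_mul_le_Lp_mul_Lq (volume.restrict S) hpp.symm
    (by fun_prop) hh.aemeasurable).trans ?_
  gcongr
  have h1 : ∀ y : Ed d, ENNReal.ofReal (exp (-b * ‖y - x‖ ^ 2)) ^ p' =
      ENNReal.ofReal (exp (-(p' * b) * ‖y - x‖ ^ 2)) := by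
    intro y
    rw [ENNReal.ofReal_rpow_of_nonneg (exp_pos _).le hp'.le, ← exp_mul]
    congr 2
    ring
  simp_rw [h1]
  calc (∫⁻ y in S, ENNReal.ofReal (exp (-(p' * b) * ‖y - x‖ ^ 2))) ^ (1 / p')
      ≤ (∫⁻ y, ENNReal.ofReal (exp (-(p' * b) * ‖y - x‖ ^ 2))) ^ (1 / p') := by
        gcongr
        exact Measure.restrict_le_self
    _ = _ := by
        rw [lintegral_exp_neg_mul_sq_norm (by positivity),
          ENNReal.ofReal_rpow_of_nonneg (by positivity) (by positivity), ← rpow_mul (by positivity),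
          mul_one_div]

theorem measurable_setLIntegral_closedBall {d : ℕ} {h : ℝ → Ed d → ℝ≥0∞}
    (hh : Measurable (Function.uncurry h)) :
    Measurable fun w : ℝ × Ed d => ∫⁻ y in Metric.closedBall w.2 1, h w.1 y := by
  have hS : MeasurableSet {v : (ℝ × Ed d) × Ed d | dist v.2 v.1.2 ≤ 1} :=
    measurableSet_le (by fun_prop) (by fun_prop)
  have h1 : ∀ w : ℝ × Ed d, ∫⁻ y in Metric.closedBall w.2 1, h w.1 y =
      ∫⁻ y, {v : (ℝ × Ed d) × Ed d | dist v.2 v.1.2 ≤ 1}.indicator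
        (fun v => h v.1.1 v.2) (w, y) := by
    intro w
    rw [← lintegral_indicator Metric.isClosed_closedBall.measurableSet]
    rfl
  simp_rw [h1]
  refine Measurable.lintegral_prod_right' (Measurable.indicator ?_ hS)
  exact hh.comp (by fun_prop : Measurable fun v : (ℝ × Ed d) × Ed d => (v.1.1, v.2))

/-- A weighted Cauchy–Schwarz inequality for two terms. -/
theorem sq_le_add_mul_of_le_add {u v w a b : ℝ} (ha : 0 < a) (hb : 0 < b) (hw : 0 ≤ w)
    (h : w ≤ u + v) : w ^ 2 ≤ (a + b) * (u ^ 2 / a + v ^ 2 / b) := by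
  have h1 : w ^ 2 ≤ (u + v) ^ 2 := by gcongr
  have h2 : (a + b) * (u ^ 2 / a + v ^ 2 / b) - (u + v) ^ 2 = (b * u - a * v) ^ 2 / (a * b) := by
    field_simp
    ring
  have h3 : 0 ≤ (b * u - a * v) ^ 2 / (a * b) := by positivity
  linarith

/-- The product of the two kernels is dominated by the kernel over the whole time interval times a
sum of two Gaussians centred at the fixed end points. The gap between `K` and `2 * K` is what
allows the second Gaussian to be centred at `y`. -/
theorem gaussK_mul_rpow_le {d : ℕ} {K a b : ℝ} (hK : 0 < K) (ha : 0 < a) (hb : 0 < b)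
    (x y' y : Ed d) :
    gaussK d K a x y' * a ^ (-(1 : ℝ) / 2) * (b ^ (-(1 : ℝ) / 2) * gaussK d (2 * K) b y' y) ≤
      2 * (2 * K * π) ^ (-(d : ℝ) / 2) * (a + b) ^ (-(1 : ℝ) / 2) * gaussK d (2 * K) (a + b) x y *
        (a ^ (-(1 : ℝ) / 2 - d / 2) * exp (-‖y' - x‖ ^ 2 / (32 * K * a)) +
          b ^ (-(1 : ℝ) / 2 - d / 2) * exp (-‖y' - y‖ ^ 2 / (32 * K * b))) := by
  have hw : ‖y - x‖ ≤ ‖y' - x‖ + ‖y' - y‖ := by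
    rw [norm_sub_rev y' y, add_comm]
    simpa using norm_add_le (y - y') (y' - x)
  have half : ∀ c : ℝ, (a + b) / 2 ≤ c → c ^ (-(1 : ℝ) / 2) ≤ 2 * (a + b) ^ (-(1 : ℝ) / 2) := by
    intro c hc
    calc c ^ (-(1 : ℝ) / 2) ≤ ((a + b) / 4) ^ (-(1 : ℝ) / 2) :=
          rpow_le_rpow_of_nonpos (by positivity) (by linarith) (by norm_num)
      _ = 2 * (a + b) ^ (-(1 : ℝ) / 2) := by
          rw [div_rpow (by positivity) (by norm_num), show (4 : ℝ) = 2 ^ (2 : ℝ) by norm_num,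
            ← rpow_mul (by norm_num)]
          norm_num [rpow_neg_one]
          ring
  have hd : -(d : ℝ) / 2 ≤ 0 := by
    have : (0 : ℝ) ≤ d := d.cast_nonneg
    linarith
  have hsplit : ∀ c : ℝ, 0 < c → c ^ (-(1 : ℝ) / 2 - d / 2) =
      c ^ (-(1 : ℝ) / 2) * c ^ (-(d : ℝ) / 2) := by
    intro c hc
    rw [← rpow_add hc]
    ring_nf
  rw [norm_sub_rev y' y] at *
  unfold gaussK
  set m := -(d : ℝ) / 2
  set n := -(1 : ℝ) / 2
  have key : ∀ c e f Q : ℝ, 0 < c → (a + b) / 2 ≤ e →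
      (4 * K * π * a) ^ m * (4 * (2 * K) * π * b) ^ m ≤
        (2 * K * π) ^ m * (4 * (2 * K) * π * (a + b)) ^ m * c ^ m →
      a ^ n * b ^ n = c ^ n * e ^ n →
      -‖y' - x‖ ^ 2 / (4 * K * a) + -‖y - y'‖ ^ 2 / (4 * (2 * K) * b) ≤
        -‖y - x‖ ^ 2 / (4 * (2 * K) * (a + b)) + f →
      c ^ n * c ^ m * exp f ≤ Q →
      (4 * K * π * a) ^ m * exp (-‖y' - x‖ ^ 2 / (4 * K * a)) * a ^ n *
        (b ^ n * ((4 * (2 * K) * π * b) ^ m * exp (-‖y - y'‖ ^ 2 / (4 * (2 * K) * b)))) ≤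
      2 * (2 * K * π) ^ m * (a + b) ^ n *
        ((4 * (2 * K) * π * (a + b)) ^ m * exp (-‖y - x‖ ^ 2 / (4 * (2 * K) * (a + b)))) * Q := by
    intro c e f Q hc he h1 h2 h3 h4
    calc _ = ((4 * K * π * a) ^ m * (4 * (2 * K) * π * b) ^ m) * (a ^ n * b ^ n) *
          exp (-‖y' - x‖ ^ 2 / (4 * K * a) + -‖y - y'‖ ^ 2 / (4 * (2 * K) * b)) := by
          rw [exp_add]
          ring
      _ ≤ ((2 * K * π) ^ m * (4 * (2 * K) * π * (a + b)) ^ m * c ^ m) *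
          (c ^ n * (2 * (a + b) ^ n)) *
          exp (-‖y - x‖ ^ 2 / (4 * (2 * K) * (a + b)) + f) := by
          have he0 : 0 ≤ e := by linarith
          rw [h2]
          gcongr
          exact half e he
      _ = 2 * (2 * K * π) ^ m * (a + b) ^ n *
        ((4 * (2 * K) * π * (a + b)) ^ m * exp (-‖y - x‖ ^ 2 / (4 * (2 * K) * (a + b)))) *
          (c ^ n * c ^ m * exp f) := by
          rw [exp_add]
          ring
      _ ≤ _ := by gcongr
  rcases le_total a b with hab | hab
  · refine key a b (-‖y' - x‖ ^ 2 / (32 * K * a)) _ ha (by linarith) ?_ rfl ?_ ?_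
    · calc (4 * K * π * a) ^ m * (4 * (2 * K) * π * b) ^ m
          ≤ (4 * K * π * a) ^ m * (4 * K * π * (a + b)) ^ m := by
            gcongr ?_ * ?_
            refine rpow_le_rpow_of_nonpos (by positivity) ?_ hd
            nlinarith [mul_pos hK pi_pos]
        _ = _ := by
            rw [← mul_rpow (by positivity) (by positivity),
              ← mul_rpow (by positivity) (by positivity),
              ← mul_rpow (by positivity) (by positivity)]
            ring_nf
    · have h1 := sq_le_add_mul_of_le_add ha hb (norm_nonneg _) hw
      have h2 : ‖y - x‖ ^ 2 / (4 * (2 * K) * (a + b)) ≤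
          (‖y' - x‖ ^ 2 / a + ‖y - y'‖ ^ 2 / b) / (8 * K) := by
        rw [div_le_div_iff₀ (by positivity) (by positivity)]
        nlinarith
      have h3 : (‖y' - x‖ ^ 2 / a + ‖y - y'‖ ^ 2 / b) / (8 * K) =
          ‖y' - x‖ ^ 2 / (4 * K * a) + ‖y - y'‖ ^ 2 / (4 * (2 * K) * b) -
            ‖y' - x‖ ^ 2 / (32 * K * a) - 3 * (‖y' - x‖ ^ 2 / (32 * K * a)) := by
        field_simp
        ring
      have h4 : 0 ≤ ‖y' - x‖ ^ 2 / (32 * K * a) := by positivity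
      simp only [neg_div]
      linarith
    · rw [hsplit a ha]
      have : 0 ≤ b ^ (n - d / 2) * exp (-‖y - y'‖ ^ 2 / (32 * K * b)) := by positivity
      linarith
  · refine key b a (-‖y - y'‖ ^ 2 / (32 * K * b)) _ hb (by linarith) ?_ (mul_comm _ _) ?_ ?_
    · calc (4 * K * π * a) ^ m * (4 * (2 * K) * π * b) ^ m
          ≤ (2 * K * π * (a + b)) ^ m * (4 * (2 * K) * π * b) ^ m := by
            gcongr ?_ * ?_
            refine rpow_le_rpow_of_nonpos (by positivity) ?_ hd
            nlinarith [mul_pos hK pi_pos]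
        _ = _ := by
            rw [← mul_rpow (by positivity) (by positivity),
              ← mul_rpow (by positivity) (by positivity),
              ← mul_rpow (by positivity) (by positivity)]
            ring_nf
    · have h1 := sq_le_add_mul_of_le_add (half_pos ha) (by positivity : 0 < 4 * b / 3)
        (norm_nonneg _) hw
      have h0 : 0 ≤ ‖y' - x‖ ^ 2 / (a / 2) + ‖y - y'‖ ^ 2 / (4 * b / 3) := by positivity
      have h2 : ‖y - x‖ ^ 2 / (4 * (2 * K) * (a + b)) ≤
          (‖y' - x‖ ^ 2 / (a / 2) + ‖y - y'‖ ^ 2 / (4 * b / 3)) / (8 * K) := by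
        rw [div_le_div_iff₀ (by positivity) (by positivity)]
        have h5 : ‖y - x‖ ^ 2 ≤
            (a + b) * (‖y' - x‖ ^ 2 / (a / 2) + ‖y - y'‖ ^ 2 / (4 * b / 3)) :=
          h1.trans (mul_le_mul_of_nonneg_right (by linarith) h0)
        nlinarith
      have h3 : (‖y' - x‖ ^ 2 / (a / 2) + ‖y - y'‖ ^ 2 / (4 * b / 3)) / (8 * K) =
          ‖y' - x‖ ^ 2 / (4 * K * a) + ‖y - y'‖ ^ 2 / (4 * (2 * K) * b) -
            ‖y - y'‖ ^ 2 / (32 * K * b) := by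
        field_simp
        ring
      simp only [neg_div]
      linarith
    · rw [hsplit b hb]
      have : 0 ≤ a ^ (n - d / 2) * exp (-‖y' - x‖ ^ 2 / (32 * K * a)) := by positivity
      linarith

theorem setLIntegral_sub_rpow {s t θ : ℝ} (hst : s < t) (hθ : θ < 1) :
    ∫⁻ r in Set.Ioo s t, ENNReal.ofReal ((r - s) ^ (-θ)) =
      ENNReal.ofReal ((t - s) ^ (1 - θ) / (1 - θ)) := by
  have hi : IntervalIntegrable (fun r : ℝ => (r - s) ^ (-θ)) volume s t := by
    have := (intervalIntegral.intervalIntegrable_rpow' (a := 0) (b := t - s)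
      (by linarith : -1 < -θ)).comp_sub_right s
    simpa using this
  have hv : ∫ r in s..t, (r - s) ^ (-θ) = (t - s) ^ (1 - θ) / (1 - θ) := by
    rw [intervalIntegral.integral_comp_sub_right (fun r => r ^ (-θ)) s,
      integral_rpow (Or.inl (by linarith)), sub_self, zero_rpow (by linarith), sub_zero,
      neg_add_eq_sub]
  rw [← hv, intervalIntegral.integral_of_le hst.le,
    ofReal_integral_eq_lintegral_ofReal ((intervalIntegrable_iff_integrableOn_Ioc_of_le hst.le).1 hi),
    restrict_Ioo_eq_restrict_Ioc]
  exact (ae_restrict_iff' measurableSet_Ioc).2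
    (Eventually.of_forall fun r hr => rpow_nonneg (sub_nonneg.2 hr.1.le) _)

theorem setLIntegral_sub_rpow' {s t θ : ℝ} (hst : s < t) (hθ : θ < 1) :
    ∫⁻ r in Set.Ioo s t, ENNReal.ofReal ((t - r) ^ (-θ)) =
      ENNReal.ofReal ((t - s) ^ (1 - θ) / (1 - θ)) := by
  rw [← setLIntegral_sub_rpow hst hθ, ← lintegral_indicator measurableSet_Ioo,
    ← lintegral_indicator measurableSet_Ioo, ← lintegral_sub_left_eq_self _ (s + t)]
  refine lintegral_congr fun r => ?_
  have h1 : s + t - r ∈ Set.Ioo s t ↔ r ∈ Set.Ioo s t := by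
    constructor <;> rintro ⟨h, h'⟩ <;> constructor <;> linarith
  simp only [Set.indicator_apply, h1]
  ring_nf

/-- On a unit ball around `z`, half of the Gaussian decay can be traded for decay in `z`. -/
theorem exp_neg_sq_norm_div_le {d : ℕ} {κ T e : ℝ} (hκ : 0 < κ) (he : 0 < e) (heT : e ≤ T)
    {x y z : Ed d} (hy : y ∈ Metric.closedBall z 1) :
    exp (-‖y - x‖ ^ 2 / (κ * e)) ≤ exp (1 / (2 * κ * T)) *
      exp (-(1 / (4 * κ * T)) * ‖z - x‖ ^ 2) * exp (-(1 / (2 * κ * e)) * ‖y - x‖ ^ 2) := by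
  have hT : 0 < T := he.trans_le heT
  rw [← exp_add, ← exp_add, exp_le_exp]
  have h1 : ‖z - x‖ ≤ 1 + ‖y - x‖ := by
    have : ‖z - y‖ ≤ 1 := by rw [← dist_eq_norm]; exact Metric.mem_closedBall'.1 hy
    calc ‖z - x‖ = ‖(z - y) + (y - x)‖ := by simp
      _ ≤ _ := (norm_add_le _ _).trans (by gcongr)
  have h2 : ‖z - x‖ ^ 2 ≤ 2 + 2 * ‖y - x‖ ^ 2 := by
    nlinarith [norm_nonneg (z - x), sq_nonneg (1 - ‖y - x‖)]
  have h3 : ‖y - x‖ ^ 2 / (2 * κ * T) ≤ ‖y - x‖ ^ 2 / (2 * κ * e) := by gcongr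
  have h4 : ‖z - x‖ ^ 2 / (4 * κ * T) ≤ (2 + 2 * ‖y - x‖ ^ 2) / (4 * κ * T) := by gcongr
  have h5 : (2 + 2 * ‖y - x‖ ^ 2) / (4 * κ * T) =
      1 / (2 * κ * T) + ‖y - x‖ ^ 2 / (2 * κ * T) := by
    field_simp
    ring
  have h6 : -‖y - x‖ ^ 2 / (κ * e) =
      -(‖y - x‖ ^ 2 / (2 * κ * e)) - ‖y - x‖ ^ 2 / (2 * κ * e) := by
    field_simp
    ring
  rw [h6, neg_mul, neg_mul, one_div_mul_eq_div, one_div_mul_eq_div]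
  linarith

/-- Space-time integral of a localized `L^q L^p` function against a Gaussian with fixed centre. -/
theorem exists_setLIntegral_gauss_le (d : ℕ) {T κ p p' q q' : ℝ} (hT : 0 < T) (hκ : 0 < κ)
    (hpp : p.HolderConjugate p') (hqq : q.HolderConjugate q') :
    ∃ C > 0, ∀ (I : Set ℝ) (e : ℝ → ℝ) (h : ℝ → Ed d → ℝ≥0∞) (N : ℝ≥0∞) (x : Ed d),
      MeasurableSet I → Measurable e → (∀ r ∈ I, 0 < e r ∧ e r ≤ T) →
      Measurable (Function.uncurry h) →
      (∀ z, (∫⁻ r in I, (∫⁻ y in Metric.closedBall z 1, h r y ^ p) ^ (q / p)) ^ (1 / q) ≤ N) →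
      ∫⁻ r in I, ∫⁻ y, ENNReal.ofReal
          (e r ^ (-(1 : ℝ) / 2 - d / 2) * exp (-‖y - x‖ ^ 2 / (κ * e r))) * h r y ≤
        ENNReal.ofReal C *
          (∫⁻ r in I, ENNReal.ofReal (e r ^ (-((1 / 2 + d / p / 2) * q')))) ^ (1 / q') * N := by
  have hp' : 0 < p' := hpp.symm.pos
  have hv : 0 < (volume (Metric.closedBall (0 : Ed d) 1)).toReal :=
    ENNReal.toReal_pos (Metric.measure_closedBall_pos volume _ one_pos).ne'
      measure_closedBall_lt_top.ne
  have hV := ENNReal.ofReal_toReal (measure_closedBall_lt_top (μ := volume) (x := (0 : Ed d))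
    (r := 1)).ne
  set v := (volume (Metric.closedBall (0 : Ed d) 1)).toReal
  set A := exp (1 / (2 * κ * T)) * (2 * κ * π / p') ^ ((d : ℝ) / 2 / p') with hA
  set W := (π / (1 / (4 * κ * T))) ^ ((d : ℝ) / 2)
  have hA0 : 0 < A := by positivity
  have hW0 : 0 < W := by positivity
  refine ⟨v⁻¹ * (A * W), by positivity, fun I e h N x hI he heI hh hN => ?_⟩
  set α := 1 / 2 + (d : ℝ) / p / 2 with hα
  set w : Ed d → ℝ := fun z => exp (-(1 / (4 * κ * T)) * ‖z - x‖ ^ 2)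
  set F : ℝ → Ed d → ℝ≥0∞ := fun r y => ENNReal.ofReal
    (e r ^ (-(1 : ℝ) / 2 - d / 2) * exp (-‖y - x‖ ^ 2 / (κ * e r))) * h r y
  have hFm : ∀ r, Measurable (F r) := fun r =>
    Measurable.mul (by fun_prop) (hh.comp measurable_prodMk_left)
  have hHm : Measurable fun u : ℝ × Ed d =>
      (∫⁻ y in Metric.closedBall u.2 1, h u.1 y ^ p) ^ (1 / p) :=
    (measurable_setLIntegral_closedBall (h := fun r y => h r y ^ p) (hh.pow_const p)).pow_const _
  have hball : ∀ r ∈ I, ∀ z, ∫⁻ y in Metric.closedBall z 1, F r y ≤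
      ENNReal.ofReal (A * w z) * (ENNReal.ofReal (e r ^ (-α)) *
        (∫⁻ y in Metric.closedBall z 1, h r y ^ p) ^ (1 / p)) := by
    intro r hr z
    obtain ⟨h0, h1⟩ := heI r hr
    have hexp : e r ^ (-(1 : ℝ) / 2 - d / 2) * (π / (p' * (1 / (2 * κ * e r)))) ^ ((d : ℝ) / 2 / p')
        = (2 * κ * π / p') ^ ((d : ℝ) / 2 / p') * e r ^ (-α) := by
      have h2 : π / (p' * (1 / (2 * κ * e r))) = 2 * κ * π / p' * e r := by
        field_simp
      have h3 : p'⁻¹ = 1 - p⁻¹ := by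
        have := hpp.inv_add_inv_eq_one
        linarith
      rw [h2, mul_rpow (by positivity) h0.le, mul_left_comm, ← rpow_add h0]
      congr 2
      rw [hα, div_eq_mul_inv _ p', h3]
      ring
    calc ∫⁻ y in Metric.closedBall z 1, F r y
        ≤ ∫⁻ y in Metric.closedBall z 1, ENNReal.ofReal
            (e r ^ (-(1 : ℝ) / 2 - d / 2) * (exp (1 / (2 * κ * T)) * w z)) *
            (ENNReal.ofReal (exp (-(1 / (2 * κ * e r)) * ‖y - x‖ ^ 2)) * h r y) := by
          refine setLIntegral_mono' Metric.isClosed_closedBall.measurableSet fun y hy => ?_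
          rw [← mul_assoc, ← ENNReal.ofReal_mul (by positivity), mul_assoc (e r ^ _)]
          refine mul_le_mul_left (ENNReal.ofReal_le_ofReal ?_) _
          exact mul_le_mul_of_nonneg_left (exp_neg_sq_norm_div_le hκ h0 h1 hy) (by positivity)
      _ ≤ ENNReal.ofReal (e r ^ (-(1 : ℝ) / 2 - d / 2) * (exp (1 / (2 * κ * T)) * w z)) *
            (ENNReal.ofReal ((π / (p' * (1 / (2 * κ * e r)))) ^ ((d : ℝ) / 2 / p')) *
              (∫⁻ y in Metric.closedBall z 1, h r y ^ p) ^ (1 / p)) := by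
          rw [lintegral_const_mul' _ _ ENNReal.ofReal_ne_top]
          gcongr
          exact setLIntegral_exp_mul_le hpp (by positivity) (hh.comp measurable_prodMk_left) x _
      _ = _ := by
          rw [← mul_assoc, ← ENNReal.ofReal_mul (by positivity),
            ← mul_assoc (ENNReal.ofReal (A * w z)), ← ENNReal.ofReal_mul (by positivity)]
          congr 2
          rw [hA]
          linear_combination (exp (1 / (2 * κ * T)) * w z) * hexp
  have htime : ∀ z, ∫⁻ r in I, ENNReal.ofReal (e r ^ (-α)) *
        (∫⁻ y in Metric.closedBall z 1, h r y ^ p) ^ (1 / p) ≤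
      (∫⁻ r in I, ENNReal.ofReal (e r ^ (-(α * q')))) ^ (1 / q') * N := by
    intro z
    refine (ENNReal.lintegral_mul_le_Lp_mul_Lq (volume.restrict I) hqq.symm
      (by fun_prop) (hHm.comp measurable_prodMk_right).aemeasurable).trans ?_
    refine mul_le_mul' (le_of_eq ?_) (le_trans (le_of_eq ?_) (hN z))
    · congr 1
      refine setLIntegral_congr_fun hI fun r hr => ?_
      have h0 := (heI r hr).1
      rw [ENNReal.ofReal_rpow_of_nonneg (by positivity) hqq.symm.nonneg, ← rpow_mul h0.le, neg_mul]
    · simp only [Function.comp_apply, ← ENNReal.rpow_mul, one_div_mul_eq_div]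
  have hmain : volume (Metric.closedBall (0 : Ed d) 1) * ∫⁻ r in I, ∫⁻ y, F r y ≤
      ENNReal.ofReal (A * W) *
        ((∫⁻ r in I, ENNReal.ofReal (e r ^ (-(α * q')))) ^ (1 / q') * N) := by
    calc volume (Metric.closedBall (0 : Ed d) 1) * ∫⁻ r in I, ∫⁻ y, F r y
        = ∫⁻ r in I, ∫⁻ z, ∫⁻ y in Metric.closedBall z 1, F r y := by
          rw [← lintegral_const_mul' _ _ measure_closedBall_lt_top.ne]
          exact lintegral_congr fun r => (lintegral_lintegral_closedBall (hFm r)).symm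
      _ ≤ ∫⁻ r in I, ∫⁻ z, ENNReal.ofReal (A * w z) * (ENNReal.ofReal (e r ^ (-α)) *
            (∫⁻ y in Metric.closedBall z 1, h r y ^ p) ^ (1 / p)) :=
          setLIntegral_mono' hI fun r hr => lintegral_mono (hball r hr)
      _ = ∫⁻ z, ∫⁻ r in I, ENNReal.ofReal (A * w z) * (ENNReal.ofReal (e r ^ (-α)) *
            (∫⁻ y in Metric.closedBall z 1, h r y ^ p) ^ (1 / p)) := by
          refine lintegral_lintegral_swap (Measurable.aemeasurable ?_)
          exact Measurable.mul (by fun_prop) (Measurable.mul (by fun_prop) hHm)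
      _ ≤ ∫⁻ z, ENNReal.ofReal (A * w z) *
            ((∫⁻ r in I, ENNReal.ofReal (e r ^ (-(α * q')))) ^ (1 / q') * N) := by
          refine lintegral_mono fun z => ?_
          rw [lintegral_const_mul' _ _ ENNReal.ofReal_ne_top]
          gcongr
          exact htime z
      _ = _ := by
          rw [lintegral_mul_const _ (by fun_prop)]
          simp_rw [ENNReal.ofReal_mul hA0.le]
          rw [lintegral_const_mul' _ _ ENNReal.ofReal_ne_top,
            lintegral_exp_neg_mul_sq_norm (by positivity)]
  calc ∫⁻ r in I, ∫⁻ y, F r y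
      = ENNReal.ofReal v⁻¹ *
          (volume (Metric.closedBall (0 : Ed d) 1) * ∫⁻ r in I, ∫⁻ y, F r y) := by
        rw [← hV, ← mul_assoc, ← ENNReal.ofReal_mul (by positivity), inv_mul_cancel₀ hv.ne',
          ENNReal.ofReal_one, one_mul]
    _ ≤ ENNReal.ofReal v⁻¹ * (ENNReal.ofReal (A * W) *
          ((∫⁻ r in I, ENNReal.ofReal (e r ^ (-(α * q')))) ^ (1 / q') * N)) := by gcongr
    _ = _ := by
        rw [← mul_assoc, ← mul_assoc, ← ENNReal.ofReal_mul (by positivity)]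

/-- the two-sided Gaussian convolution estimate (CK):
`∫_s^t ∫ p̃^{K,r−s}(x,y') (r−s)^{-1/2} g_r(y') (t−r)^{-1/2} p̃^{2K,t−r}(y',y) dy' dr
  ≤ c (t−s)^{-1/2+δ} p̃^{2K,t−s}(x,y) ‖g‖_{L̃_p^q([s,t])}`. -/
theorem stmt9 (d : ℕ) (hd : 1 ≤ d) (T K p q : ℝ) (hT : 0 < T) (hK : 0 < K)
    (hp : 1 < p) (hq : 1 < q) (hpq : (d : ℝ) / p + 2 / q < 1) :
    ∃ c > 0, ∀ s t : ℝ, 0 ≤ s → s < t → t ≤ T →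
      ∀ g : ℝ → Ed d → ℝ, Measurable (Function.uncurry g) → (∀ u x, 0 ≤ g u x) →
        tnorm d p q s t g < ⊤ → ∀ x y : Ed d,
          (∫⁻ r in Set.Ioo s t, ∫⁻ y',
              ENNReal.ofReal (gaussK d K (r - s) x y' * (r - s) ^ (-(1 : ℝ) / 2) *
                g r y' * (t - r) ^ (-(1 : ℝ) / 2) * gaussK d (2 * K) (t - r) y' y)) ≤
            ENNReal.ofReal (c * (t - s) ^ (-(1 : ℝ) / 2 + (1 - (d : ℝ) / p - 2 / q) / 2) *
                gaussK d (2 * K) (t - s) x y) * tnorm d p q s t g := by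
  have hp0 : 0 < p := by linarith
  have hq0 : 0 < q := by linarith
  have hpp := Real.HolderConjugate.conjExponent hp
  have hqq := Real.HolderConjugate.conjExponent hq
  set q' := q.conjExponent
  have hq' : 0 < q' := hqq.symm.pos
  have hqinv : q'⁻¹ = 1 - q⁻¹ := by
    have := hqq.inv_add_inv_eq_one
    linarith
  set α := 1 / 2 + (d : ℝ) / p / 2 with hα
  have hδ : (1 - α * q') * (1 / q') = (1 - (d : ℝ) / p - 2 / q) / 2 := by
    rw [sub_mul, mul_assoc, mul_one_div_cancel hq'.ne', one_mul, one_div, hqinv, hα]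
    ring
  have hθ : α * q' < 1 := by
    have h1 : 0 < (1 - α * q') * (1 / q') := by
      rw [hδ]
      linarith
    have := pos_of_mul_pos_left h1 (by positivity)
    linarith
  obtain ⟨C, hC, hmain⟩ :=
    exists_setLIntegral_gauss_le d hT (by positivity : 0 < 32 * K) hpp hqq
  set D := (1 - α * q')⁻¹ ^ (1 / q')
  have hD0 : 0 < D := rpow_pos_of_pos (inv_pos.2 (by linarith)) _
  refine ⟨2 * (2 * K * π) ^ (-(d : ℝ) / 2) * (2 * (C * D)), by positivity, ?_⟩
  intro s t hs hst htT g hg hg0 _ x y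
  set h : ℝ → Ed d → ℝ≥0∞ := fun r y' => ENNReal.ofReal (g r y') with hh
  have hhm : Measurable (Function.uncurry h) := hg.ennreal_ofReal
  have hτ : 0 < t - s := sub_pos.2 hst
  set N := tnorm d p q s t g
  have hN : ∀ z, (∫⁻ r in Set.Ioo s t,
      (∫⁻ y in Metric.closedBall z 1, h r y ^ p) ^ (q / p)) ^ (1 / q) ≤ N := by
    intro z
    refine le_trans ?_ (le_iSup (fun z : Ed d => (∫⁻ u in Set.Icc s t,
      (∫⁻ x in Metric.closedBall z 1, ENNReal.ofReal (|g u x| ^ p)) ^ (q / p)) ^ (1 / q)) z)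
    simp only [hh, abs_of_nonneg (hg0 _ _), ENNReal.ofReal_rpow_of_nonneg (hg0 _ _) hp0.le]
    gcongr
    exact Set.Ioo_subset_Icc_self
  have htime : (ENNReal.ofReal ((t - s) ^ (1 - α * q') / (1 - α * q'))) ^ (1 / q') =
      ENNReal.ofReal ((t - s) ^ ((1 - (d : ℝ) / p - 2 / q) / 2) * D) := by
    have h1 : 0 < 1 - α * q' := by linarith
    rw [ENNReal.ofReal_rpow_of_nonneg (by positivity) (by positivity), div_eq_mul_inv,
      mul_rpow (by positivity) (by positivity), ← rpow_mul hτ.le, hδ]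
  have hleft := hmain (Set.Ioo s t) (fun r => r - s) h N x measurableSet_Ioo (by fun_prop)
    (fun r hr => ⟨sub_pos.2 hr.1, by linarith [hr.2]⟩) hhm hN
  have hright := hmain (Set.Ioo s t) (fun r => t - r) h N y measurableSet_Ioo (by fun_prop)
    (fun r hr => ⟨sub_pos.2 hr.2, by linarith [hr.1]⟩) hhm hN
  rw [setLIntegral_sub_rpow hst hθ, htime] at hleft
  rw [setLIntegral_sub_rpow' hst hθ, htime] at hright
  set B := 2 * (2 * K * π) ^ (-(d : ℝ) / 2) * (t - s) ^ (-(1 : ℝ) / 2) *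
    gaussK d (2 * K) (t - s) x y
  have hG : 0 ≤ gaussK d (2 * K) (t - s) x y := by
    unfold gaussK
    positivity
  have hB0 : 0 ≤ B := by positivity
  set k : ℝ → Ed d → Ed d → ℝ := fun e x y' =>
    e ^ (-(1 : ℝ) / 2 - d / 2) * exp (-‖y' - x‖ ^ 2 / (32 * K * e))
  have hkm : Measurable fun w : ℝ × Ed d => ENNReal.ofReal (k (w.1 - s) x w.2) * h w.1 w.2 :=
    Measurable.mul (by fun_prop) hhm
  have hkr : ∀ r, Measurable fun y' => ENNReal.ofReal (k (r - s) x y') * h r y' := fun r =>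
    Measurable.mul (by fun_prop) (hhm.comp measurable_prodMk_left)
  have hk0 : ∀ e x y', 0 < e → 0 ≤ k e x y' := fun e x y' he => by positivity
  calc _ ≤ ∫⁻ r in Set.Ioo s t, ∫⁻ y', ENNReal.ofReal B *
        (ENNReal.ofReal (k (r - s) x y') * h r y' + ENNReal.ofReal (k (t - r) y y') * h r y') := by
        refine setLIntegral_mono' measurableSet_Ioo fun r hr => lintegral_mono fun y' => ?_
        have h1 : 0 < r - s := sub_pos.2 hr.1
        have h2 : 0 < t - r := sub_pos.2 hr.2
        rw [← add_mul, ← ENNReal.ofReal_add (hk0 _ _ _ h1) (hk0 _ _ _ h2), ← mul_assoc,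
          ← ENNReal.ofReal_mul hB0, ← ENNReal.ofReal_mul
            (mul_nonneg hB0 (add_nonneg (hk0 _ _ _ h1) (hk0 _ _ _ h2)))]
        refine ENNReal.ofReal_le_ofReal ?_
        have h3 := mul_le_mul_of_nonneg_right (gaussK_mul_rpow_le hK h1 h2 x y' y) (hg0 r y')
        rw [show r - s + (t - r) = t - s by ring] at h3
        refine le_trans (le_of_eq ?_) h3
        ring
    _ = ENNReal.ofReal B *
        ((∫⁻ r in Set.Ioo s t, ∫⁻ y', ENNReal.ofReal (k (r - s) x y') * h r y') +
          ∫⁻ r in Set.Ioo s t, ∫⁻ y', ENNReal.ofReal (k (t - r) y y') * h r y') := by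
        rw [← lintegral_add_left hkm.lintegral_prod_right',
          ← lintegral_const_mul' _ _ ENNReal.ofReal_ne_top]
        refine lintegral_congr fun r => ?_
        rw [lintegral_const_mul' _ _ ENNReal.ofReal_ne_top,
          lintegral_add_left (hkr r)]
    _ ≤ ENNReal.ofReal B *
        (ENNReal.ofReal C * ENNReal.ofReal ((t - s) ^ ((1 - (d : ℝ) / p - 2 / q) / 2) * D) * N +
          ENNReal.ofReal C * ENNReal.ofReal ((t - s) ^ ((1 - (d : ℝ) / p - 2 / q) / 2) * D) * N) :=
        mul_le_mul_right (add_le_add hleft hright) _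
    _ = _ := by
        rw [← two_mul, ← mul_assoc, ← mul_assoc, ← mul_assoc, ← ENNReal.ofReal_ofNat 2,
          ← ENNReal.ofReal_mul hB0, ← ENNReal.ofReal_mul (by positivity),
          ← ENNReal.ofReal_mul (by positivity), rpow_add hτ]
        congr 2
        ring
end
end

section
/- Let d ≥ 1, T > 0, p > 1, and 1 < q' < q. Let f : [0,T]×ℝ^d → [0,∞) be measurable with ‖f‖_{L̃_p^q([0,T])} < ∞. Then lim_{N→∞} sup_{0 ≤ s ≤ r ≤ T} ( ‖e^{-N(r−·)} f‖_{L̃_p^{q'}([s,r])} + e^{-N(r−s)} √(r−s) ) = 0, where e^{-N(r−·)}f denotes the function (u,x) ↦ e^{-N(r−u)} f(u,x) on [s,r]×ℝ^d. -/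
open MeasureTheory Real Filter
open scoped ENNReal RealInnerProductSpace

noncomputable section

theorem lintegral_exp_neg_mul_sub_Icc_le {c : ℝ} (hc : 0 < c) (s r : ℝ) :
    ∫⁻ u in Set.Icc s r, ENNReal.ofReal (Real.exp (-c * (r - u))) ≤ ENNReal.ofReal (1 / c) := by
  have hfun : ∀ u : ℝ, Real.exp (-c * (r - u)) = Real.exp (-(c * r)) * Real.exp (c * u) := by
    intro u
    rw [← Real.exp_add]
    ring_nf
  calc ∫⁻ u in Set.Icc s r, ENNReal.ofReal (Real.exp (-c * (r - u)))
      ≤ ∫⁻ u in Set.Iic r, ENNReal.ofReal (Real.exp (-c * (r - u))) :=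
        lintegral_mono_set Set.Icc_subset_Iic_self
    _ = ENNReal.ofReal (∫ u in Set.Iic r, Real.exp (-c * (r - u))) := by
        rw [ofReal_integral_eq_lintegral_ofReal]
        · simp_rw [hfun]
          exact (integrableOn_exp_mul_Iic hc r).const_mul _
        · exact Eventually.of_forall fun u => (Real.exp_pos _).le
    _ = ENNReal.ofReal (1 / c) := by
        simp_rw [hfun]
        rw [integral_const_mul, integral_exp_mul_Iic hc, mul_div_assoc', ← Real.exp_add]
        simp

theorem exp_neg_mul_mul_sqrt_le {N x : ℝ} (hN : 0 < N) (hx : 0 ≤ x) :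
    Real.exp (-N * x) * √x ≤ 1 / √N := by
  have hNx : 0 ≤ N * x := mul_nonneg hN.le hx
  have h1 : √x * √N ≤ Real.exp (N * x) := by
    rw [mul_comm, ← Real.sqrt_mul hN.le]
    have h2 := Real.add_one_le_exp (N * x)
    have h3 := Real.sq_sqrt hNx
    nlinarith [sq_nonneg (√(N * x) - 1), Real.sqrt_nonneg (N * x)]
  rw [le_div_iff₀ (Real.sqrt_pos.mpr hN), mul_assoc, neg_mul, Real.exp_neg,
    inv_mul_le_iff₀ (Real.exp_pos _), mul_one]
  exact h1

/-- Hölder's inequality in time for the exponentially damped localized norm. -/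
theorem tnorm_exp_mul_le {d : ℕ} {p q q' m N s r T : ℝ} (hp : 0 < p) (hq' : 0 < q')
    (hq'q : q' < q) (hm : 0 < m) (hqm : 1 / q' = 1 / q + 1 / m) (hN : 0 < N)
    (hs : 0 ≤ s) (hr : r ≤ T) {f : ℝ → Ed d → ℝ} (hfm : Measurable (Function.uncurry f)) :
    tnorm d p q' s r (fun u x => Real.exp (-N * (r - u)) * f u x) ≤
      tnorm d p q 0 T f * ENNReal.ofReal (1 / (N * m)) ^ (1 / m) := by
  have hq : 0 < q := hq'.trans hq'q
  unfold tnorm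
  refine iSup_le fun z => ?_
  set G : ℝ → ℝ≥0∞ := fun u => ∫⁻ x in Metric.closedBall z 1, ENNReal.ofReal (|f u x| ^ p) with hG
  have hGm : Measurable G := by
    refine Measurable.lintegral_prod_right'
      (f := fun y : ℝ × Ed d => ENNReal.ofReal (|f y.1 y.2| ^ p)) ?_
    have h : Measurable fun y : ℝ × Ed d => f y.1 y.2 := hfm
    exact (((continuous_abs.measurable.comp h).pow_const p)).ennreal_ofReal
  have hinner : ∀ u, (∫⁻ x in Metric.closedBall z 1,
      ENNReal.ofReal (|Real.exp (-N * (r - u)) * f u x| ^ p)) ^ (q' / p) =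
      (G u ^ (1 / p) * ENNReal.ofReal (Real.exp (-N * (r - u)))) ^ q' := by
    intro u
    have hE : ∀ x, ENNReal.ofReal (|Real.exp (-N * (r - u)) * f u x| ^ p) =
        ENNReal.ofReal (Real.exp (-N * (r - u))) ^ p * ENNReal.ofReal (|f u x| ^ p) := by
      intro x
      rw [abs_mul, Real.abs_exp, Real.mul_rpow (Real.exp_pos _).le (abs_nonneg _),
        ENNReal.ofReal_mul (by positivity), ENNReal.ofReal_rpow_of_pos (Real.exp_pos _)]
    simp_rw [hE]
    rw [lintegral_const_mul' _ _ (by simp [ENNReal.rpow_eq_top_iff, hp.not_gt]),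
      ENNReal.mul_rpow_of_nonneg _ _ (by positivity), ENNReal.mul_rpow_of_nonneg _ _ hq'.le,
      ← ENNReal.rpow_mul, ← ENNReal.rpow_mul, mul_comm]
    congr 2 <;> field_simp
  simp_rw [hinner]
  have hholder := ENNReal.lintegral_Lp_mul_le_Lq_mul_Lr hq' hq'q hqm
    (volume.restrict (Set.Icc s r)) (f := fun u => G u ^ (1 / p))
    (g := fun u => ENNReal.ofReal (Real.exp (-N * (r - u))))
    (hGm.pow_const _).aemeasurable (by fun_prop)
  refine hholder.trans (mul_le_mul' ?_ ?_)
  · refine le_trans ?_ (le_iSup _ z)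
    refine ENNReal.rpow_le_rpow ?_ (by positivity)
    refine (lintegral_mono_set (Set.Icc_subset_Icc hs hr)).trans (le_of_eq ?_)
    refine lintegral_congr fun u => ?_
    rw [← ENNReal.rpow_mul, one_div_mul_eq_div]
  · refine ENNReal.rpow_le_rpow ?_ (by positivity)
    refine le_trans (le_of_eq ?_) (lintegral_exp_neg_mul_sub_Icc_le (mul_pos hN hm) s r)
    refine lintegral_congr fun u => ?_
    rw [ENNReal.ofReal_rpow_of_pos (Real.exp_pos _), ← Real.exp_mul]
    ring_nf

/-- the limit
`lim_{N→∞} sup_{0 ≤ s ≤ r ≤ T} ( ‖e^{-N(r−·)} f‖_{L̃_p^{q'}([s,r])} + e^{-N(r−s)}√(r−s) ) = 0`. -/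
theorem stmt14 (d : ℕ) (hd : 1 ≤ d) (T : ℝ) (hT : 0 < T) (p q q' : ℝ)
    (hp : 1 < p) (hq' : 1 < q') (hq'q : q' < q)
    (f : ℝ → Ed d → ℝ) (hfm : Measurable (Function.uncurry f))
    (hf0 : ∀ u x, 0 ≤ f u x) (hff : tnorm d p q 0 T f < ⊤) :
    Filter.Tendsto
      (fun N : ℝ =>
        ⨆ (s : ℝ) (r : ℝ) (_ : 0 ≤ s ∧ s ≤ r ∧ r ≤ T),
          tnorm d p q' s r (fun u x => Real.exp (-N * (r - u)) * f u x) +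
            ENNReal.ofReal (Real.exp (-N * (r - s)) * Real.sqrt (r - s)))
      Filter.atTop (nhds (0 : ℝ≥0∞)) := by
  have hq'0 : 0 < q' := by linarith
  have hq0 : 0 < q := by linarith
  obtain ⟨m, hm, hqm⟩ : ∃ m : ℝ, 0 < m ∧ 1 / q' = 1 / q + 1 / m := by
    refine ⟨(1 / q' - 1 / q)⁻¹, inv_pos.mpr (sub_pos.mpr (one_div_lt_one_div_of_lt hq'0 hq'q)), ?_⟩
    rw [one_div (_⁻¹), inv_inv]
    ring
  have hlim : Tendsto (fun N : ℝ => tnorm d p q 0 T f * ENNReal.ofReal (1 / (N * m)) ^ (1 / m) +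
      ENNReal.ofReal (1 / √N)) atTop (nhds 0) := by
    have h1 : Tendsto (fun N : ℝ => ENNReal.ofReal (1 / (N * m))) atTop (nhds 0) := by
      rw [← ENNReal.ofReal_zero]
      exact ENNReal.tendsto_ofReal ((tendsto_id.atTop_mul_const hm).const_div_atTop 1)
    have h2 : Tendsto (fun N : ℝ => ENNReal.ofReal (1 / √N)) atTop (nhds 0) := by
      rw [← ENNReal.ofReal_zero]
      exact ENNReal.tendsto_ofReal (Real.tendsto_sqrt_atTop.const_div_atTop 1)
    have h3 := h1.ennrpow_const (1 / m)
    rw [ENNReal.zero_rpow_of_pos (by positivity)] at h3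
    have h4 := (ENNReal.Tendsto.const_mul h3 (Or.inr hff.ne)).add h2
    simpa only [mul_zero, add_zero] using h4
  refine tendsto_of_tendsto_of_tendsto_of_le_of_le' tendsto_const_nhds hlim
    (Eventually.of_forall fun _ => zero_le) ?_
  filter_upwards [eventually_gt_atTop 0] with N hN
  refine iSup_le fun s => iSup_le fun r => iSup_le fun ⟨hs, hsr, hr⟩ => ?_
  exact add_le_add (tnorm_exp_mul_le (by linarith) hq'0 hq'q hm hqm hN hs hr hfm)
    (ENNReal.ofReal_le_ofReal (exp_neg_mul_mul_sqrt_le hN (sub_nonneg.mpr hsr)))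
end
end
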